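/- arXiv:1304.5659 — 10 statements merged into one kernel-verified Lean document; each statement's English description precedes it below -/
import Mathlib

section
/- Let ε : ℕ → ℝ satisfy ε i ∈ {-1, 1} for every i ≥ 1, and let (c_n)_{n≥0} be any real sequence with c_n ∈ [-2, 2] for all n. Then the sequence (r_n(c_n))_{n≥0} converges and lim_{n→∞} r_n(c_n) = 2·sin((1 + Σ_{i=1}^∞ (ε₁ε₂⋯ε_i)/2^i)·π/4). -/
open Filter Real

/-- The nested radical `r_n(c) = √(2 + ε₁√(2 + ε₂√(2 + ⋯ + ε_n√(2 + c))))`,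
defined by the recursion `r₀(c) = √(2 + c)`, `r_n(c) = r_{n-1}(ε_n √(2 + c))`. -/
noncomputable def nest (ε : ℕ → ℝ) : ℕ → ℝ → ℝ
  | 0, c => Real.sqrt (2 + c)
  | n + 1, c => nest ε n (ε (n + 1) * Real.sqrt (2 + c))

/-- The half-angle identity behind one step of the radical. -/
theorem sqrt_two_add_two_mul_sin {x : ℝ} (hx : x ∈ Set.Icc (-2 : ℝ) 2) :
    √(2 + 2 * sin (x * (π / 4))) = 2 * sin ((1 + x / 2) * (π / 4)) := by
  have hπ := pi_pos
  have hnonneg : 0 ≤ sin ((1 + x / 2) * (π / 4)) :=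
    sin_nonneg_of_nonneg_of_le_pi
      (mul_nonneg (by linarith [hx.1]) (by positivity)) (by nlinarith [hx.2])
  have hsq : 2 + 2 * sin (x * (π / 4)) = (2 * sin ((1 + x / 2) * (π / 4))) ^ 2 := by
    have h : sin (x * (π / 4)) = -cos (2 * ((1 + x / 2) * (π / 4))) := by
      rw [show 2 * ((1 + x / 2) * (π / 4)) = x * (π / 4) + π / 2 by ring,
        cos_add_pi_div_two, neg_neg]
    rw [h, cos_two_mul, cos_sq']
    ring
  rw [hsq, sqrt_sq (by positivity)]

theorem nest_two_mul_sin (ε : ℕ → ℝ) (hε : ∀ i, 1 ≤ i → ε i = 1 ∨ ε i = -1)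
    (n : ℕ) {x : ℝ} (hx : x ∈ Set.Icc (-2 : ℝ) 2) :
    nest ε n (2 * sin (x * (π / 4))) =
      2 * sin ((1 + ∑ i ∈ Finset.range n, (∏ j ∈ Finset.Icc 1 (i + 1), ε j) / 2 ^ (i + 1) +
        (∏ j ∈ Finset.Icc 1 n, ε j) * x / 2 ^ (n + 1)) * (π / 4)) := by
  induction n generalizing x with
  | zero => simpa [nest] using sqrt_two_add_two_mul_sin hx
  | succ n ih =>
    have hstep : ε (n + 1) * √(2 + 2 * sin (x * (π / 4))) =
        2 * sin (ε (n + 1) * (1 + x / 2) * (π / 4)) := by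
      rw [sqrt_two_add_two_mul_sin hx]
      rcases hε (n + 1) (by omega) with h | h <;> rw [h]
      · simp only [one_mul]
      · simp only [neg_mul, one_mul, mul_neg, sin_neg]
    have hmem : ε (n + 1) * (1 + x / 2) ∈ Set.Icc (-2 : ℝ) 2 := by
      rcases hε (n + 1) (by omega) with h | h <;> rw [h] <;>
        constructor <;> linarith [hx.1, hx.2]
    rw [nest, hstep, ih hmem, Finset.sum_range_succ, Finset.prod_Icc_succ_top (by omega)]
    congr 3
    field_simp
    ring

theorem abs_prod_signs (ε : ℕ → ℝ) (hε : ∀ i, 1 ≤ i → ε i = 1 ∨ ε i = -1) (n : ℕ) :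
    |∏ j ∈ Finset.Icc 1 n, ε j| = 1 := by
  rw [Finset.abs_prod]
  refine Finset.prod_eq_one fun j hj => ?_
  rcases hε j (Finset.mem_Icc.1 hj).1 with h | h <;> simp [h]

theorem summable_prod_signs (ε : ℕ → ℝ) (hε : ∀ i, 1 ≤ i → ε i = 1 ∨ ε i = -1) :
    Summable fun i : ℕ => (∏ j ∈ Finset.Icc 1 (i + 1), ε j) / 2 ^ (i + 1) := by
  refine .of_norm_bounded ((summable_nat_add_iff 1).2 summable_geometric_two) fun i => ?_
  rw [norm_div, norm_eq_abs, abs_prod_signs ε hε]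
  simp

theorem exists_eq_two_mul_sin {c : ℝ} (hc : c ∈ Set.Icc (-2 : ℝ) 2) :
    ∃ x ∈ Set.Icc (-2 : ℝ) 2, c = 2 * sin (x * (π / 4)) := by
  have hπ := pi_pos
  have hx : arcsin (c / 2) / (π / 4) * (π / 4) = arcsin (c / 2) := by field_simp
  refine ⟨arcsin (c / 2) / (π / 4), ⟨?_, ?_⟩, ?_⟩
  · rw [le_div_iff₀ (by positivity)]
    linarith [neg_pi_div_two_le_arcsin (c / 2)]
  · rw [div_le_iff₀ (by positivity)]
    linarith [arcsin_le_pi_div_two (c / 2)]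
  · rw [hx, sin_arcsin (by linarith [hc.1]) (by linarith [hc.2])]
    ring

/-- Theorem 1: for any sign sequence `ε` and any sequence `c_n ∈ [-2, 2]`, the
sequence `r_n(c_n)` converges to `2 sin((1 + Σ_{i=1}^∞ ε₁⋯ε_i/2^i)·π/4)`. -/
theorem continued_radical_tendsto (ε : ℕ → ℝ) (hε : ∀ i, 1 ≤ i → ε i = 1 ∨ ε i = -1)
    (c : ℕ → ℝ) (hc : ∀ n, c n ∈ Set.Icc (-2 : ℝ) 2) :
    Filter.Tendsto (fun n => nest ε n (c n)) Filter.atTop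
      (nhds (2 * Real.sin
        ((1 + ∑' i : ℕ, (∏ j ∈ Finset.Icc 1 (i + 1), ε j) / 2 ^ (i + 1)) * (π / 4)))) := by
  choose x hx hcx using fun n => exists_eq_two_mul_sin (hc n)
  have hrem : Tendsto (fun n => (∏ j ∈ Finset.Icc 1 n, ε j) * x n / 2 ^ (n + 1)) atTop (nhds 0) := by
    refine squeeze_zero_norm (fun n => ?_)
      (tendsto_pow_atTop_nhds_zero_of_lt_one (r := (1 / 2 : ℝ)) (by norm_num) (by norm_num))
    rw [norm_div, norm_mul, norm_eq_abs, abs_prod_signs ε hε, one_mul, norm_eq_abs,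
      norm_of_nonneg (by positivity), div_le_iff₀ (by positivity), pow_succ, ← mul_assoc,
      ← mul_pow]
    norm_num
    exact abs_le.2 (hx n)
  have hsum := (summable_prod_signs ε hε).hasSum.tendsto_sum_nat
  have harg := ((hsum.const_add 1).add hrem).mul_const (π / 4)
  rw [add_zero] at harg
  refine (((continuous_sin.tendsto _).comp harg).const_mul 2).congr fun n => ?_
  rw [hcx n, nest_two_mul_sin ε hε n (hx n)]
  rfl
end

section
/- Let ε : ℕ → ℝ satisfy ε i ∈ {-1, 1} for every i ≥ 1. Then for every n ≥ 1 and every real c_n ∈ [-2, 2], either r_{n−1}(0) ≤ r_n(c_n) ≤ r_n(2) or r_{n−1}(0) ≥ r_n(c_n) ≥ r_n(2). -/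
open Filter Real

/-- Each nested radical is monotone or antitone in its innermost argument. -/
theorem nest_monotone_or_antitone (ε : ℕ → ℝ) (hε : ∀ i, 1 ≤ i → ε i = 1 ∨ ε i = -1) (n : ℕ) :
    Monotone (nest ε n) ∨ Antitone (nest ε n) := by
  have hsqrt : Monotone fun c : ℝ => √(2 + c) := fun a b hab =>
    Real.sqrt_le_sqrt (by linarith)
  induction n with
  | zero => exact Or.inl hsqrt
  | succ n ih =>
    have hinner : Monotone (fun c : ℝ => ε (n + 1) * √(2 + c)) ∨
        Antitone (fun c : ℝ => ε (n + 1) * √(2 + c)) := by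
      rcases hε (n + 1) (by lia) with h | h
      · left
        simpa only [h, one_mul] using hsqrt
      · right
        simpa only [h, neg_one_mul] using hsqrt.neg
    rcases ih with ho | ho <;> rcases hinner with hi | hi
    · exact Or.inl (ho.comp hi)
    · exact Or.inr (ho.comp_antitone hi)
    · exact Or.inr (ho.comp_monotone hi)
    · exact Or.inl (ho.comp hi)

/-- Lemma 1.1 (ii): for every `n ≥ 1` and every `c ∈ [-2, 2]`, either
`r_{n-1}(0) ≤ r_n(c) ≤ r_n(2)` or `r_{n-1}(0) ≥ r_n(c) ≥ r_n(2)`. -/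
theorem nest_between (ε : ℕ → ℝ) (hε : ∀ i, 1 ≤ i → ε i = 1 ∨ ε i = -1)
    (n : ℕ) (hn : 1 ≤ n) (c : ℝ) (hc : c ∈ Set.Icc (-2 : ℝ) 2) :
    (nest ε (n - 1) 0 ≤ nest ε n c ∧ nest ε n c ≤ nest ε n 2) ∨
    (nest ε n 2 ≤ nest ε n c ∧ nest ε n c ≤ nest ε (n - 1) 0) := by
  obtain ⟨m, rfl⟩ := Nat.exists_eq_add_of_le' hn
  have h0 : 0 ≤ √(2 + c) := Real.sqrt_nonneg _
  have h2 : √(2 + c) ≤ 2 := Real.sqrt_le_iff.2 ⟨by norm_num, by linarith [hc.2]⟩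
  have h4 : √(2 + 2 : ℝ) = 2 := by
    rw [Real.sqrt_eq_iff_mul_self_eq] <;> norm_num
  simp only [Nat.add_sub_cancel, nest, h4]
  rcases hε (m + 1) hn with h | h <;> rw [h] <;>
    rcases nest_monotone_or_antitone ε hε m with hm | hm
  · exact Or.inl ⟨hm (by linarith), hm (by linarith)⟩
  · exact Or.inr ⟨hm (by linarith), hm (by linarith)⟩
  · exact Or.inr ⟨hm (by linarith), hm (by linarith)⟩
  · exact Or.inl ⟨hm (by linarith), hm (by linarith)⟩
end

section
/- Let A be the set of sign sequences ε : ℕ → ℝ with ε i ∈ {-1, 1} for all i ≥ 1 such that there exists k ≥ 1 with ε_k = ε_{k+1} = −1 and ε_i = 1 for all i ≥ k+2. Define ψ(ε) = lim_{n→∞} r_n (this limit exists for every sign sequence ε). Then ψ, restricted to sign sequences not lying in A, is a bijection onto the interval [0, 2]: distinct sign sequences outside A have distinct limits, and every x ∈ [0, 2] equals ψ(ε) for some sign sequence ε not in A. -/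
open Filter Real

/-- `ε` is a sign sequence: `ε i ∈ {-1, 1}` for all `i ≥ 1`. -/
def IsSign (ε : ℕ → ℝ) : Prop := ∀ i, 1 ≤ i → ε i = 1 ∨ ε i = -1

/-- The exceptional set `A`: sequences having, for some `k ≥ 1`,
`ε_k = ε_{k+1} = -1` and `ε_i = 1` for all `i ≥ k + 2`. -/
def InA (ε : ℕ → ℝ) : Prop :=
  ∃ k, 1 ≤ k ∧ ε k = -1 ∧ ε (k + 1) = -1 ∧ ∀ i, k + 2 ≤ i → ε i = 1

theorem nest_nonneg (ε : ℕ → ℝ) (n : ℕ) (c : ℝ) : 0 ≤ nest ε n c := by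
  induction n generalizing c with
  | zero => exact Real.sqrt_nonneg _
  | succ n ih => exact ih _

theorem nest_le_two {ε : ℕ → ℝ} (hε : IsSign ε) (n : ℕ) {c : ℝ} (hc : c ≤ 2) :
    nest ε n c ≤ 2 := by
  induction n generalizing c with
  | zero => exact Real.sqrt_le_iff.2 ⟨by norm_num, by linarith⟩
  | succ n ih =>
    have h2 : √(2 + c) ≤ 2 := Real.sqrt_le_iff.2 ⟨by norm_num, by linarith⟩
    have h0 := Real.sqrt_nonneg (2 + c)
    refine ih ?_
    rcases hε (n + 1) (by omega) with h | h <;> rw [h] <;> linarith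

/-- Peeling off the outermost radical of `nest` shifts the sign sequence. -/
theorem nest_succ_eq_sqrt (ε : ℕ → ℝ) (n : ℕ) (c : ℝ) :
    nest ε (n + 1) c = √(2 + ε 1 * nest (fun i => ε (i + 1)) n c) := by
  induction n generalizing c with
  | zero => rfl
  | succ n ih => exact ih _

theorem IsSign.shift {ε : ℕ → ℝ} (hε : IsSign ε) : IsSign fun i => ε (i + 1) :=
  fun i _ => hε (i + 1) (by omega)

theorem InA.of_shift {ε : ℕ → ℝ} (h : InA fun i => ε (i + 1)) : InA ε := by
  obtain ⟨k, hk, h1, h2, h3⟩ := h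
  refine ⟨k + 1, by omega, h1, h2, fun i hi => ?_⟩
  have : ε (i - 1 + 1) = 1 := h3 (i - 1) (by omega)
  rwa [Nat.sub_add_cancel (by omega)] at this

theorem limit_mem_Icc {ε : ℕ → ℝ} (hε : IsSign ε) {L : ℝ}
    (hL : Tendsto (fun n => nest ε n 0) atTop (nhds L)) : L ∈ Set.Icc (0 : ℝ) 2 :=
  isClosed_Icc.mem_of_tendsto hL
    (.of_forall fun n => ⟨nest_nonneg ε n 0, nest_le_two hε n (by norm_num)⟩)

theorem tendsto_shift {ε : ℕ → ℝ} (hε : IsSign ε) {L : ℝ}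
    (hL : Tendsto (fun n => nest ε n 0) atTop (nhds L)) :
    Tendsto (fun n => nest (fun i => ε (i + 1)) n 0) atTop (nhds (ε 1 * (L ^ 2 - 2))) := by
  have h := (((hL.comp (tendsto_add_atTop_nat 1)).pow 2).sub_const 2).const_mul (ε 1)
  refine h.congr fun n => ?_
  have h0 := nest_nonneg (fun i => ε (i + 1)) n 0
  have h2 := nest_le_two hε.shift n (c := 0) (by norm_num)
  simp only [Function.comp, nest_succ_eq_sqrt]
  rcases hε 1 le_rfl with h | h <;> rw [h, Real.sq_sqrt (by linarith)] <;> ring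

theorem eq_one_of_tendsto_two {ε : ℕ → ℝ} (hε : IsSign ε)
    (hL : Tendsto (fun n => nest ε n 0) atTop (nhds 2)) {i : ℕ} (hi : 1 ≤ i) : ε i = 1 := by
  induction i, hi using Nat.le_induction generalizing ε with
  | base =>
    have h := (limit_mem_Icc hε.shift (tendsto_shift hε hL)).1
    rcases hε 1 le_rfl with h1 | h1
    · exact h1
    · rw [h1] at h
      norm_num at h
  | succ n hn ih =>
    have h := tendsto_shift hε hL
    rcases hε 1 le_rfl with h1 | h1
    · refine ih hε.shift ?_
      rw [h1] at h
      norm_num at h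
      exact h
    · have hb := (limit_mem_Icc hε.shift h).1
      rw [h1] at hb
      norm_num at hb

/-- Outside `A`, the first sign is `1` as soon as the first inner radical tends to `0`. -/
theorem first_sign_eq_one {ε : ℕ → ℝ} (hε : IsSign ε) (hA : ¬ InA ε)
    (hL : Tendsto (fun n => nest (fun i => ε (i + 1)) n 0) atTop (nhds 0)) : ε 1 = 1 := by
  by_contra hne
  have h1 : ε 1 = -1 := (hε 1 le_rfl).resolve_left hne
  have ht := tendsto_shift hε.shift hL
  have hb := (limit_mem_Icc hε.shift.shift ht).1
  have h2 : ε 2 = -1 := by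
    refine (hε 2 (by omega)).resolve_left fun h => ?_
    simp [h] at hb
    linarith
  simp only [Nat.reduceAdd, h2] at ht
  norm_num at ht
  refine hA ⟨1, le_rfl, h1, h2, fun i hi => ?_⟩
  have := eq_one_of_tendsto_two hε.shift.shift ht (i := i - 2) (by omega)
  rwa [show i - 2 + 1 + 1 = i by omega] at this

theorem first_sign_eq {ε ε' : ℕ → ℝ} (hε : IsSign ε) (hε' : IsSign ε') (hA : ¬ InA ε)
    (hA' : ¬ InA ε') {L : ℝ} (hL : Tendsto (fun n => nest ε n 0) atTop (nhds L))
    (hL' : Tendsto (fun n => nest ε' n 0) atTop (nhds L)) : ε 1 = ε' 1 := by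
  have ht := tendsto_shift hε hL
  have ht' := tendsto_shift hε' hL'
  by_cases h0 : L ^ 2 - 2 = 0
  · rw [h0, mul_zero] at ht ht'
    rw [first_sign_eq_one hε hA ht, first_sign_eq_one hε' hA' ht']
  · have hb := (limit_mem_Icc hε.shift ht).1
    have hb' := (limit_mem_Icc hε'.shift ht').1
    rcases hε 1 le_rfl with h | h <;> rcases hε' 1 le_rfl with h' | h' <;>
      rw [h] at hb ⊢ <;> rw [h'] at hb' ⊢ <;> exact absurd (by linarith) h0

theorem sign_eq_of_tendsto {ε ε' : ℕ → ℝ} (hε : IsSign ε) (hε' : IsSign ε') (hA : ¬ InA ε)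
    (hA' : ¬ InA ε') {L : ℝ} (hL : Tendsto (fun n => nest ε n 0) atTop (nhds L))
    (hL' : Tendsto (fun n => nest ε' n 0) atTop (nhds L)) {i : ℕ} (hi : 1 ≤ i) :
    ε i = ε' i := by
  have h1 := first_sign_eq hε hε' hA hA' hL hL'
  induction i, hi using Nat.le_induction generalizing ε ε' L with
  | base => exact h1
  | succ n hn ih =>
    have ht := tendsto_shift hε hL
    have ht' := tendsto_shift hε' hL'
    rw [← h1] at ht'
    have hs := mt InA.of_shift hA
    have hs' := mt InA.of_shift hA'
    exact ih hε.shift hε'.shift hs hs' ht ht' (first_sign_eq hε.shift hε'.shift hs hs' ht ht')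

theorem sqrt_two_add_two_mul_cos {θ : ℝ} (h : θ ∈ Set.Icc 0 π) :
    √(2 + 2 * cos θ) = 2 * cos (θ / 2) := by
  have hc : 0 ≤ cos (θ / 2) :=
    cos_nonneg_of_mem_Icc ⟨by linarith [h.1, pi_pos], by linarith [h.2]⟩
  rw [show 2 + 2 * cos θ = (2 * cos (θ / 2)) ^ 2 by
    rw [show θ = 2 * (θ / 2) by ring, cos_two_mul]; ring_nf]
  exact Real.sqrt_sq (by linarith)

/-- In the angular coordinate `c = 2 cos θ`, each radical halves distances. -/
theorem abs_nest_sub_nest_le {ε : ℕ → ℝ} (hε : IsSign ε) (n : ℕ) {θ φ : ℝ}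
    (hθ : θ ∈ Set.Icc 0 π) (hφ : φ ∈ Set.Icc 0 π) :
    |nest ε n (2 * cos θ) - nest ε n (2 * cos φ)| ≤ |θ - φ| / 2 ^ n := by
  induction n generalizing θ φ with
  | zero =>
    simp only [nest, sqrt_two_add_two_mul_cos hθ, sqrt_two_add_two_mul_cos hφ]
    have h := abs_cos_sub_cos_le (θ / 2) (φ / 2)
    rw [← mul_sub, abs_mul, abs_two]
    rw [← sub_div, abs_div, abs_two] at h
    simp only [pow_zero, div_one]
    linarith
  | succ n ih =>
    simp only [nest, sqrt_two_add_two_mul_cos hθ, sqrt_two_add_two_mul_cos hφ]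
    obtain ⟨h1, h2⟩ := hθ
    obtain ⟨h3, h4⟩ := hφ
    have hhalf : |θ / 2 - φ / 2| / 2 ^ n = |θ - φ| / 2 ^ (n + 1) := by
      rw [← sub_div, abs_div, abs_two, pow_succ]
      ring
    rw [← hhalf]
    rcases hε (n + 1) (by omega) with h | h <;> rw [h]
    · simp only [one_mul]
      exact ih ⟨by linarith, by linarith⟩ ⟨by linarith, by linarith⟩
    · have := ih (θ := π - θ / 2) (φ := π - φ / 2) ⟨by linarith, by linarith⟩
        ⟨by linarith, by linarith⟩
      rw [cos_pi_sub, cos_pi_sub, sub_sub_sub_cancel_left, abs_sub_comm (φ / 2)] at this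
      convert this using 4 <;> ring

theorem abs_nest_sub_nest_zero_le {ε : ℕ → ℝ} (hε : IsSign ε) (n : ℕ) {c : ℝ}
    (hc : c ∈ Set.Icc (-2 : ℝ) 2) : |nest ε n 0 - nest ε n c| ≤ π / 2 ^ n := by
  have h0 := arccos_nonneg (c / 2)
  have h1 := arccos_le_pi (c / 2)
  have h := abs_nest_sub_nest_le hε n (θ := π / 2) (φ := arccos (c / 2))
    ⟨by linarith [pi_pos], by linarith [pi_pos]⟩ ⟨h0, h1⟩
  rw [cos_pi_div_two, cos_arccos (by linarith [hc.1]) (by linarith [hc.2]), mul_zero,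
    mul_div_cancel₀ c two_ne_zero] at h
  refine h.trans (div_le_div_of_nonneg_right ?_ (by positivity))
  rw [abs_le]
  constructor <;> linarith [pi_pos]

/-- The map `x ↦ |x² - 2|` sending a nested radical to its first inner radical. -/
noncomputable def innerRadical (x : ℝ) : ℝ := |x ^ 2 - 2|

/-- The sign sequence of the nested radical expansion of `x`. -/
noncomputable def expansionSign (x : ℝ) (n : ℕ) : ℝ :=
  if (innerRadical^[n - 1] x) ^ 2 < 2 then -1 else 1

theorem isSign_expansionSign (x : ℝ) : IsSign (expansionSign x) := fun i _ => by
  unfold expansionSign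
  split_ifs <;> simp

theorem iterate_innerRadical_mem_Icc {x : ℝ} (hx : x ∈ Set.Icc (0 : ℝ) 2) (n : ℕ) :
    innerRadical^[n] x ∈ Set.Icc (0 : ℝ) 2 := by
  induction n with
  | zero => exact hx
  | succ n ih =>
    rw [Function.iterate_succ_apply']
    exact ⟨abs_nonneg _, abs_le.2 ⟨by nlinarith [ih.1], by nlinarith [ih.1, ih.2]⟩⟩

theorem expansionSign_mul_innerRadical (x : ℝ) (n : ℕ) :
    expansionSign x (n + 1) * innerRadical^[n + 1] x = (innerRadical^[n] x) ^ 2 - 2 := by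
  rw [Function.iterate_succ_apply', innerRadical, expansionSign, Nat.add_sub_cancel]
  split_ifs with h
  · rw [abs_of_neg (by linarith)]
    ring
  · rw [abs_of_nonneg (by linarith)]
    ring

theorem nest_expansionSign {x : ℝ} (hx : x ∈ Set.Icc (0 : ℝ) 2) (n : ℕ) :
    nest (expansionSign x) n ((innerRadical^[n] x) ^ 2 - 2) = x := by
  induction n with
  | zero =>
    simp only [nest, Function.iterate_zero, id, add_sub_cancel]
    exact Real.sqrt_sq hx.1
  | succ n ih =>
    simp only [nest, add_sub_cancel]
    rw [Real.sqrt_sq (iterate_innerRadical_mem_Icc hx _).1, expansionSign_mul_innerRadical, ih]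

theorem tendsto_nest_expansionSign {x : ℝ} (hx : x ∈ Set.Icc (0 : ℝ) 2) :
    Tendsto (fun n => nest (expansionSign x) n 0) atTop (nhds x) := by
  have hlim : Tendsto (fun n : ℕ => π / 2 ^ n) atTop (nhds 0) :=
    tendsto_const_nhds.div_atTop (tendsto_pow_atTop_atTop_of_one_lt one_lt_two)
  refine tendsto_iff_dist_tendsto_zero.2 (squeeze_zero (fun _ => dist_nonneg) (fun n => ?_) hlim)
  obtain ⟨h0, h2⟩ := iterate_innerRadical_mem_Icc hx n
  have h := abs_nest_sub_nest_zero_le (isSign_expansionSign x) n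
    (c := (innerRadical^[n] x) ^ 2 - 2) ⟨by nlinarith, by nlinarith⟩
  rwa [nest_expansionSign hx] at h

/-- Only the point `2` has a forward orbit on which `x ^ 2 < 2` never holds. -/
theorem eq_two_of_forall_two_le_sq {y : ℝ} (hy : y ∈ Set.Icc (0 : ℝ) 2)
    (h : ∀ m, 2 ≤ (innerRadical^[m] y) ^ 2) : y = 2 := by
  by_contra hne
  have hlt : 0 < 2 - y := sub_pos.2 (lt_of_le_of_ne hy.2 hne)
  have hgrow (m : ℕ) : 2 ^ m * (2 - y) ≤ 2 - innerRadical^[m] y := by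
    induction m with
    | zero => simp
    | succ m ih =>
      obtain ⟨h0, h2⟩ := iterate_innerRadical_mem_Icc hy m
      rw [Function.iterate_succ_apply', innerRadical, abs_of_nonneg (by linarith [h m]), pow_succ]
      nlinarith
  obtain ⟨m, hm⟩ := pow_unbounded_of_one_lt (2 / (2 - y)) (one_lt_two (α := ℝ))
  rw [div_lt_iff₀ hlt] at hm
  linarith [hgrow m, (iterate_innerRadical_mem_Icc hy m).1]

theorem not_inA_expansionSign {x : ℝ} (hx : x ∈ Set.Icc (0 : ℝ) 2) :
    ¬ InA (expansionSign x) := by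
  rintro ⟨k, hk, h1, h2, h3⟩
  obtain ⟨k, rfl⟩ := Nat.exists_eq_add_of_le' hk
  have hy : innerRadical^[k + 2] x = 2 := by
    refine eq_two_of_forall_two_le_sq (iterate_innerRadical_mem_Icc hx _) fun m => ?_
    rw [← Function.iterate_add_apply]
    by_contra hlt
    have h := h3 (m + (k + 2) + 1) (by omega)
    rw [expansionSign, Nat.add_sub_cancel, if_pos (not_le.1 hlt)] at h
    norm_num at h
  have e2 := expansionSign_mul_innerRadical x (k + 1)
  have e1 := expansionSign_mul_innerRadical x k
  rw [h2, hy] at e2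
  have hz : innerRadical^[k + 1] x = 0 := by nlinarith
  rw [hz, mul_zero] at e1
  rw [expansionSign, Nat.add_sub_cancel, if_neg (by linarith)] at h1
  norm_num at h1

/-- Theorem 2: `ψ(ε) = lim r_n`, restricted to sign sequences not in `A`, is a
bijection onto `[0, 2]`: the limit lies in `[0, 2]`, distinct sign sequences
outside `A` (i.e. differing at some index `i ≥ 1`) have distinct limits, and
every `x ∈ [0, 2]` is attained. -/
theorem psi_bijective :
    (∀ ε : ℕ → ℝ, IsSign ε → ¬ InA ε → ∀ L : ℝ,
      Filter.Tendsto (fun n => nest ε n 0) Filter.atTop (nhds L) →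
        L ∈ Set.Icc (0 : ℝ) 2) ∧
    (∀ ε ε' : ℕ → ℝ, IsSign ε → IsSign ε' → ¬ InA ε → ¬ InA ε' → ∀ L : ℝ,
      Filter.Tendsto (fun n => nest ε n 0) Filter.atTop (nhds L) →
      Filter.Tendsto (fun n => nest ε' n 0) Filter.atTop (nhds L) →
        ∀ i, 1 ≤ i → ε i = ε' i) ∧
    (∀ x ∈ Set.Icc (0 : ℝ) 2, ∃ ε : ℕ → ℝ, IsSign ε ∧ ¬ InA ε ∧
      Filter.Tendsto (fun n => nest ε n 0) Filter.atTop (nhds x)) := by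
  exact ⟨fun _ hε _ _ hL => limit_mem_Icc hε hL,
    fun _ _ hε hε' hA hA' _ hL hL' _ hi => sign_eq_of_tendsto hε hε' hA hA' hL hL' hi,
    fun x hx => ⟨expansionSign x, isSign_expansionSign x, not_inA_expansionSign hx,
      tendsto_nest_expansionSign hx⟩⟩
end

section
/- Let φ be a real number with 0 < φ < π/2 such that cos(2^n·φ) ≠ 0 for every n ≥ 1. Define the sign sequence ε_n = cos(2^n φ)/|cos(2^n φ)|. Then for every n ≥ 1, 2·cos φ = r_n(2·cos(2^{n+1} φ)), i.e. 2 cos φ = √(2 + ε₁√(2 + ⋯ + ε_n√(2 + 2 cos 2^{n+1} φ))). -/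
open Filter Real

theorem sqrt_two_add_two_mul_cos_two_mul (x : ℝ) :
    √(2 + 2 * Real.cos (2 * x)) = 2 * |Real.cos x| := by
  rw [Real.cos_two_mul,
    show 2 + 2 * (2 * Real.cos x ^ 2 - 1) = (2 * Real.cos x) ^ 2 by ring,
    Real.sqrt_sq_eq_abs, abs_mul, abs_two]

/-- Lemma 2.1: if `0 < φ < π/2` and `cos(2^n φ) ≠ 0` for all `n ≥ 1`, then with
`ε_n = cos(2^n φ)/|cos(2^n φ)|` one has
`2 cos φ = √(2 + ε₁√(2 + ⋯ + ε_n√(2 + 2 cos 2^{n+1} φ)))` for every `n ≥ 1`. -/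
theorem two_cos_eq_nest (φ : ℝ) (hφ0 : 0 < φ) (hφ1 : φ < π / 2)
    (hcos : ∀ n, 1 ≤ n → Real.cos (2 ^ n * φ) ≠ 0)
    (ε : ℕ → ℝ)
    (hε : ∀ n, 1 ≤ n → ε n = Real.cos (2 ^ n * φ) / |Real.cos (2 ^ n * φ)|)
    (n : ℕ) (hn : 1 ≤ n) :
    2 * Real.cos φ = nest ε n (2 * Real.cos (2 ^ (n + 1) * φ)) := by
  clear hn
  induction n with
  | zero =>
    have hpos : 0 < Real.cos φ := Real.cos_pos_of_mem_Ioo ⟨by linarith, hφ1⟩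
    rw [nest, zero_add, pow_one, sqrt_two_add_two_mul_cos_two_mul, abs_of_pos hpos]
  | succ k ih =>
    have hk : 1 ≤ k + 1 := Nat.le_add_left 1 k
    have habs : |Real.cos (2 ^ (k + 1) * φ)| ≠ 0 := abs_ne_zero.mpr (hcos _ hk)
    rw [nest, pow_succ' 2 (k + 1), mul_assoc, sqrt_two_add_two_mul_cos_two_mul, hε _ hk,
      mul_left_comm, div_mul_cancel₀ _ habs]
    exact ih
end

section
/- Let ε : ℕ → ℝ with ε i ∈ {-1, 1} for all i ≥ 1 be totally periodic (there exists p ≥ 1 with ε_{i+p} = ε_i for all i ≥ 1) and not identically equal to 1. Then lim_{n→∞} r_n = 2·cos(q·π) for some rational q with 0 < q < 1/2 whose reduced denominator is odd. -/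
open Filter Real

/-- The signed dyadic weight `ε₁ ⋯ ε_k / 2^(k+1)`. -/
noncomputable def signWeight (ε : ℕ → ℝ) (k : ℕ) : ℝ :=
  (∏ i ∈ Finset.range k, ε (i + 1)) / 2 ^ (k + 1)

/-- The terms of the series whose sum is the limiting angle, in units of `π`. -/
noncomputable def angleTerm (ε : ℕ → ℝ) (k : ℕ) : ℝ :=
  signWeight ε k * ((1 - ε (k + 1)) / 2)

/-- The angle, in units of `π`, of the limit of the nested radicals with signs `ε`. -/
noncomputable def limitAngle (ε : ℕ → ℝ) : ℝ := ∑' k, angleTerm ε k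

lemma sqrt_two_add_two_cos {t : ℝ} (h0 : 0 ≤ t) (h1 : t ≤ 1) :
    √(2 + 2 * cos (π * t)) = 2 * cos (π * (t / 2)) := by
  have hc : 0 ≤ cos (π * (t / 2)) :=
    cos_nonneg_of_mem_Icc ⟨by nlinarith [pi_pos], by nlinarith [pi_pos]⟩
  have h : 2 + 2 * cos (π * t) = (2 * cos (π * (t / 2))) ^ 2 := by
    rw [show π * t = 2 * (π * (t / 2)) by ring, cos_two_mul]
    ring
  rw [h, sqrt_sq (by positivity)]

lemma nest_two_cos {ε : ℕ → ℝ} (hε : ∀ i, 1 ≤ i → ε i = 1 ∨ ε i = -1) (n : ℕ) :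
    ∀ t : ℝ, 0 ≤ t → t ≤ 1 →
      nest ε n (2 * cos (π * t)) =
          2 * cos (π * (∑ k ∈ Finset.range n, angleTerm ε k + t * signWeight ε n)) ∧
        0 ≤ ∑ k ∈ Finset.range n, angleTerm ε k + t * signWeight ε n ∧
        ∑ k ∈ Finset.range n, angleTerm ε k + t * signWeight ε n ≤ 1 / 2 := by
  induction n with
  | zero =>
    intro t h0 h1
    refine ⟨?_, ?_, ?_⟩
    · rw [nest, sqrt_two_add_two_cos h0 h1]
      simp [signWeight, div_eq_mul_inv]
    · simp [signWeight]; linarith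
    · simp [signWeight]; linarith
  | succ n ih =>
    intro t h0 h1
    have hsum : ∑ k ∈ Finset.range (n + 1), angleTerm ε k + t * signWeight ε (n + 1) =
        ∑ k ∈ Finset.range n, angleTerm ε k +
          ((1 - ε (n + 1)) / 2 + ε (n + 1) * (t / 2)) * signWeight ε n := by
      rw [Finset.sum_range_succ, angleTerm, signWeight, signWeight, Finset.prod_range_succ,
        pow_succ _ (n + 1)]
      field_simp
      ring
    rw [hsum, nest, sqrt_two_add_two_cos h0 h1]
    rcases hε (n + 1) (by omega) with h | h
    · rw [h, one_mul, show (1 - 1) / 2 + 1 * (t / 2) = t / 2 by ring]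
      exact ih (t / 2) (by linarith) (by linarith)
    · have hcos : ε (n + 1) * (2 * cos (π * (t / 2))) = 2 * cos (π * (1 - t / 2)) := by
        rw [h, show π * (1 - t / 2) = π - π * (t / 2) by ring, cos_pi_sub]
        ring
      rw [hcos, show (1 - ε (n + 1)) / 2 + ε (n + 1) * (t / 2) = 1 - t / 2 by rw [h]; ring]
      exact ih (1 - t / 2) (by linarith) (by linarith)

lemma prod_signs {ε : ℕ → ℝ} (hε : ∀ i, 1 ≤ i → ε i = 1 ∨ ε i = -1) (k : ℕ) :
    ∏ i ∈ Finset.range k, ε (i + 1) = 1 ∨ ∏ i ∈ Finset.range k, ε (i + 1) = -1 := by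
  induction k with
  | zero => simp
  | succ k ih =>
    rw [Finset.prod_range_succ]
    rcases ih with h | h <;> rcases hε (k + 1) (by omega) with h' | h' <;> simp [h, h']

lemma abs_signWeight {ε : ℕ → ℝ} (hε : ∀ i, 1 ≤ i → ε i = 1 ∨ ε i = -1) (k : ℕ) :
    |signWeight ε k| = (1 / 2) ^ (k + 1) := by
  rcases prod_signs hε k with h | h <;> simp [signWeight, h, abs_div]

lemma summable_angleTerm {ε : ℕ → ℝ} (hε : ∀ i, 1 ≤ i → ε i = 1 ∨ ε i = -1) :
    Summable (angleTerm ε) := by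
  refine Summable.of_norm_bounded (g := fun k => (1 / 2 : ℝ) ^ (k + 1))
    ((summable_nat_add_iff 1).2 summable_geometric_two) fun k => ?_
  rw [angleTerm, norm_mul, norm_eq_abs, abs_signWeight hε]
  refine mul_le_of_le_one_right (by positivity) ?_
  rcases hε (k + 1) (by omega) with h | h <;> rw [h] <;> norm_num

lemma tendsto_angle {ε : ℕ → ℝ} (hε : ∀ i, 1 ≤ i → ε i = 1 ∨ ε i = -1) (t : ℝ) :
    Tendsto (fun n => ∑ k ∈ Finset.range n, angleTerm ε k + t * signWeight ε n) atTop
      (nhds (limitAngle ε)) := by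
  have hw : Tendsto (signWeight ε) atTop (nhds 0) := by
    rw [tendsto_zero_iff_abs_tendsto_zero]
    refine Tendsto.congr (fun k => (abs_signWeight hε k).symm) ?_
    exact (tendsto_add_atTop_iff_nat 1).2
      (tendsto_pow_atTop_nhds_zero_of_lt_one (by norm_num) (by norm_num))
  simpa [limitAngle] using
    (summable_angleTerm hε).hasSum.tendsto_sum_nat.add (hw.const_mul t)

lemma limitAngle_nonneg {ε : ℕ → ℝ} (hε : ∀ i, 1 ≤ i → ε i = 1 ∨ ε i = -1) :
    0 ≤ limitAngle ε :=
  ge_of_tendsto' (tendsto_angle hε 0) fun n => (nest_two_cos hε n 0 le_rfl zero_le_one).2.1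

lemma limitAngle_le_half {ε : ℕ → ℝ} (hε : ∀ i, 1 ≤ i → ε i = 1 ∨ ε i = -1) :
    limitAngle ε ≤ 1 / 2 :=
  le_of_tendsto' (tendsto_angle hε 0) fun n => (nest_two_cos hε n 0 le_rfl zero_le_one).2.2

lemma tendsto_nest {ε : ℕ → ℝ} (hε : ∀ i, 1 ≤ i → ε i = 1 ∨ ε i = -1) :
    Tendsto (fun n => nest ε n 0) atTop (nhds (2 * cos (limitAngle ε * π))) := by
  have hlim : Tendsto (fun n => 2 * cos (π *
      (∑ k ∈ Finset.range n, angleTerm ε k + 1 / 2 * signWeight ε n))) atTop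
      (nhds (2 * cos (π * limitAngle ε))) :=
    ((continuous_cos.tendsto _).comp ((tendsto_angle hε (1 / 2)).const_mul π)).const_mul 2
  rw [mul_comm (limitAngle ε)]
  refine hlim.congr fun n => ?_
  rw [← (nest_two_cos hε n (1 / 2) (by norm_num) (by norm_num)).1,
    show π * (1 / 2) = π / 2 by ring, cos_pi_div_two, mul_zero]

lemma limitAngle_eq_shift {ε : ℕ → ℝ} (hε : ∀ i, 1 ≤ i → ε i = 1 ∨ ε i = -1) (m : ℕ) :
    limitAngle ε = ∑ k ∈ Finset.range m, angleTerm ε k +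
      (∏ i ∈ Finset.range m, ε (i + 1)) / 2 ^ m * limitAngle fun i => ε (i + m) := by
  rw [limitAngle, ← (summable_angleTerm hε).sum_add_tsum_nat_add m, limitAngle, ← tsum_mul_left]
  congr 2
  ext k
  have hprod : ∏ i ∈ Finset.range (k + m), ε (i + 1) =
      (∏ i ∈ Finset.range m, ε (i + 1)) * ∏ i ∈ Finset.range k, ε (i + 1 + m) := by
    rw [add_comm k, Finset.prod_range_add]
    congr 1
    exact Finset.prod_congr rfl fun i _ => congrArg ε (by ring)
  rw [angleTerm, angleTerm, signWeight, signWeight, hprod,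
    show k + m + 1 = m + (k + 1) by ring, pow_add, show m + (k + 1) = k + 1 + m by ring]
  field_simp

lemma eq_one_of_limitAngle_eq_zero {ε : ℕ → ℝ} (hε : ∀ i, 1 ≤ i → ε i = 1 ∨ ε i = -1)
    (h : limitAngle ε = 0) : ∀ i, 1 ≤ i → ε i = 1 := by
  have step : ∀ j, limitAngle (fun i => ε (i + j)) = 0 →
      ε (j + 1) = 1 ∧ limitAngle (fun i => ε (i + (j + 1))) = 0 := by
    intro j hj
    have key := limitAngle_eq_shift (ε := fun i => ε (i + j)) (fun i hi => hε _ (by omega)) 1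
    have hle := limitAngle_le_half (ε := fun i => ε (i + (j + 1))) fun i hi => hε _ (by omega)
    have hs : (fun i => ε (i + 1 + j)) = fun i => ε (i + (j + 1)) := by
      ext i
      exact congrArg ε (by ring)
    simp only [hs, hj, angleTerm, signWeight, Finset.sum_range_one, Finset.prod_range_one,
      Finset.prod_range_zero, zero_add, add_comm 1 j] at key
    rcases hε (j + 1) (by omega) with h1 | h1 <;> rw [h1] at key
    · exact ⟨h1, by linarith⟩
    · linarith
  have hall : ∀ j, limitAngle (fun i => ε (i + j)) = 0 := by
    intro j
    induction j with
    | zero => exact h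
    | succ j ih => exact (step j ih).2
  intro i hi
  obtain ⟨j, rfl⟩ := Nat.exists_eq_add_of_le' hi
  exact (step j (hall j)).1

lemma exists_int_two_pow_mul_sum_angleTerm {ε : ℕ → ℝ}
    (hε : ∀ i, 1 ≤ i → ε i = 1 ∨ ε i = -1) (n : ℕ) :
    ∃ m : ℤ, (2 : ℝ) ^ n * ∑ k ∈ Finset.range n, angleTerm ε k = m := by
  induction n with
  | zero => exact ⟨0, by simp⟩
  | succ n ih =>
    obtain ⟨m, hm⟩ := ih
    have hsum : (2 : ℝ) ^ (n + 1) * ∑ k ∈ Finset.range (n + 1), angleTerm ε k =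
        2 * m + (∏ i ∈ Finset.range n, ε (i + 1)) * ((1 - ε (n + 1)) / 2) := by
      rw [← hm, Finset.sum_range_succ, angleTerm, signWeight, pow_succ]
      field_simp
    rw [hsum]
    rcases prod_signs hε n with h | h <;> rcases hε (n + 1) (by omega) with h' | h' <;>
      rw [h, h']
    · exact ⟨2 * m, by push_cast; ring⟩
    · exact ⟨2 * m + 1, by push_cast; ring⟩
    · exact ⟨2 * m, by push_cast; ring⟩
    · exact ⟨2 * m - 1, by push_cast; ring⟩

lemma limitAngle_congr {ε δ : ℕ → ℝ} (h : ∀ i, 1 ≤ i → ε i = δ i) :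
    limitAngle ε = limitAngle δ := by
  have h' : ∀ i, ε (i + 1) = δ (i + 1) := fun i => h _ (by omega)
  simp only [limitAngle, angleTerm, signWeight, h']

lemma exists_rat_odd_den_eq_limitAngle {ε : ℕ → ℝ} (hε : ∀ i, 1 ≤ i → ε i = 1 ∨ ε i = -1)
    {p : ℕ} (hp : 1 ≤ p) (hper : ∀ i, 1 ≤ i → ε (i + p) = ε i) :
    ∃ q : ℚ, Odd q.den ∧ (q : ℝ) = limitAngle ε := by
  obtain ⟨m, hm⟩ := exists_int_two_pow_mul_sum_angleTerm hε p
  obtain ⟨s, hs, hsprod⟩ : ∃ s : ℤ, (s = 1 ∨ s = -1) ∧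
      ∏ i ∈ Finset.range p, ε (i + 1) = s := by
    rcases prod_signs hε p with h | h
    · exact ⟨1, .inl rfl, by simpa using h⟩
    · exact ⟨-1, .inr rfl, by simpa using h⟩
  have hodd : Odd ((2 : ℤ) ^ p - s) := by
    have h2 : Even ((2 : ℤ) ^ p) := even_two.pow_of_ne_zero (by omega)
    refine h2.sub_odd ?_
    rcases hs with rfl | rfl <;> decide
  have hne : (2 : ℝ) ^ p - s ≠ 0 := by
    have : (2 : ℤ) ^ p - s ≠ 0 := fun h => by simp [h] at hodd
    exact_mod_cast this
  refine ⟨(m : ℚ) / ((2 ^ p - s : ℤ) : ℚ), ?_, ?_⟩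
  · have hdvd := Rat.den_dvd m (2 ^ p - s)
    rw [Rat.divInt_eq_div] at hdvd
    obtain ⟨c, hc⟩ := hdvd
    rw [hc] at hodd
    exact_mod_cast (Int.odd_mul.1 hodd).1
  · have key := limitAngle_eq_shift hε p
    rw [limitAngle_congr hper, hsprod] at key
    push_cast
    rw [div_eq_iff hne, ← hm]
    field_simp at key
    linarith

/-- Theorem 4 (forward direction): if the sign sequence `ε` is totally periodic
and not identically `1`, then `lim r_n = 2 cos(qπ)` for some rational
`q ∈ (0, 1/2)` whose reduced denominator is odd. -/
theorem totally_periodic_limit (ε : ℕ → ℝ) (hε : ∀ i, 1 ≤ i → ε i = 1 ∨ ε i = -1)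
    (p : ℕ) (hp : 1 ≤ p) (hper : ∀ i, 1 ≤ i → ε (i + p) = ε i)
    (hnontriv : ¬ ∀ i, 1 ≤ i → ε i = 1) :
    ∃ q : ℚ, 0 < q ∧ q < 1 / 2 ∧ Odd q.den ∧
      Filter.Tendsto (fun n => nest ε n 0) Filter.atTop
        (nhds (2 * Real.cos (q * π))) := by
  obtain ⟨q, hodd, hq⟩ := exists_rat_odd_den_eq_limitAngle hε hp hper
  refine ⟨q, ?_, ?_, hodd, hq ▸ tendsto_nest hε⟩
  · have h0 : (0 : ℝ) < q :=
      hq ▸ (limitAngle_nonneg hε).lt_of_ne' fun h =>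
        hnontriv (eq_one_of_limitAngle_eq_zero hε h)
    exact_mod_cast h0
  · have h1 : (q : ℝ) ≤ ((1 / 2 : ℚ) : ℝ) := by
      rw [hq]
      simpa using limitAngle_le_half hε
    refine lt_of_le_of_ne (by exact_mod_cast h1) ?_
    rintro rfl
    norm_num at hodd
end

section
/- Let s ≥ 3 be an odd integer and t an integer with gcd(t, s) = 1 and 0 < t/s < 1/2, and let ε_i = cos(2^i·tπ/s)/|cos(2^i·tπ/s)| for i ≥ 1. Then the minimal period of the totally periodic sequence (ε_i) equals min{d ≥ 1 : 2^d ≡ 1 (mod s) or 2^d ≡ −1 (mod s)}. -/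
open Filter Real

/-- On `[-1, 1]`, the map `x ↦ 2x² - 1` is conjugate by `arccos` to a tent map. -/
theorem arccos_cos_two_mul_of_nonneg {x : ℝ} (h : 0 ≤ cos x) :
    arccos (cos (2 * x)) = 2 * arccos (cos x) := by
  have hx : cos (arccos (cos x)) = cos x := cos_arccos (neg_one_le_cos x) (cos_le_one x)
  have h2 := arccos_le_pi_div_two.2 h
  have h0 := arccos_nonneg (cos x)
  rw [cos_two_mul, ← hx, ← cos_two_mul, arccos_cos (by linarith) (by linarith), hx]

theorem arccos_cos_two_mul_of_nonpos {x : ℝ} (h : cos x ≤ 0) :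
    arccos (cos (2 * x)) = 2 * π - 2 * arccos (cos x) := by
  have h' : 0 ≤ cos (π - x) := by rw [cos_pi_sub]; linarith
  have := arccos_cos_two_mul_of_nonneg h'
  rw [mul_sub, cos_two_pi_sub, cos_pi_sub, arccos_neg] at this
  linarith

theorem same_sign_of_div_abs_eq {x y : ℝ} (h : x / |x| = y / |y|) :
    (0 ≤ x ∧ 0 ≤ y) ∨ (x ≤ 0 ∧ y ≤ 0) := by
  rcases lt_trichotomy x 0 with hx | rfl | hx <;> rcases lt_trichotomy y 0 with hy | rfl | hy
  all_goals first
    | exact Or.inl ⟨by linarith, by linarith⟩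
    | exact Or.inr ⟨by linarith, by linarith⟩
    | skip
  · rw [abs_of_neg hx, abs_of_pos hy, div_neg, div_self hx.ne, div_self hy.ne'] at h
    norm_num at h
  · rw [abs_of_pos hx, abs_of_neg hy, div_neg, div_self hx.ne', div_self hy.ne] at h
    norm_num at h

/-- The signs of `cos (2 ^ k * a)`, `k ≥ 0`, determine `cos a`. -/
theorem cos_eq_of_signs_eq {a b : ℝ}
    (h : ∀ k : ℕ, cos (2 ^ k * a) / |cos (2 ^ k * a)| = cos (2 ^ k * b) / |cos (2 ^ k * b)|) :
    cos a = cos b := by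
  have key : ∀ k : ℕ, |arccos (cos (2 ^ k * a)) - arccos (cos (2 ^ k * b))|
      = 2 ^ k * |arccos (cos a) - arccos (cos b)| := by
    intro k
    induction k with
    | zero => simp
    | succ k ih =>
      rw [pow_succ', mul_assoc, mul_assoc, mul_assoc, ← ih]
      rcases same_sign_of_div_abs_eq (h k) with ⟨ha, hb⟩ | ⟨ha, hb⟩
      · rw [arccos_cos_two_mul_of_nonneg ha, arccos_cos_two_mul_of_nonneg hb, ← mul_sub,
          abs_mul, abs_two]
      · rw [arccos_cos_two_mul_of_nonpos ha, arccos_cos_two_mul_of_nonpos hb,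
          sub_sub_sub_cancel_left, ← mul_sub, abs_mul, abs_two, abs_sub_comm]
  by_contra hne
  have hpos : 0 < |arccos (cos a) - arccos (cos b)| := by
    refine abs_pos.2 (sub_ne_zero.2 fun he => hne ?_)
    exact arccos_injOn ⟨neg_one_le_cos a, cos_le_one a⟩ ⟨neg_one_le_cos b, cos_le_one b⟩ he
  obtain ⟨k, hk⟩ := pow_unbounded_of_one_lt (π / |arccos (cos a) - arccos (cos b)|) one_lt_two
  rw [div_lt_iff₀ hpos, ← key k] at hk
  refine hk.not_ge (abs_le.2 ⟨?_, ?_⟩)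
  · linarith [arccos_nonneg (cos (2 ^ k * a)), arccos_le_pi (cos (2 ^ k * b))]
  · linarith [arccos_nonneg (cos (2 ^ k * b)), arccos_le_pi (cos (2 ^ k * a))]

theorem cos_two_pow_add_eq {s : ℕ} (hs : s ≠ 0) {d : ℕ} (t : ℤ)
    (hd : Int.ModEq (s : ℤ) (2 ^ d) 1 ∨ Int.ModEq (s : ℤ) (2 ^ d) (-1)) {i : ℕ} (hi : 1 ≤ i) :
    cos (2 ^ (i + d) * t * π / s) = cos (2 ^ i * t * π / s) := by
  have hs' : (s : ℝ) ≠ 0 := Nat.cast_ne_zero.2 hs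
  obtain ⟨j, rfl⟩ := Nat.exists_eq_add_of_le' hi
  rw [eq_comm, cos_eq_cos_iff]
  rcases hd with hd | hd <;> obtain ⟨m, hm⟩ := hd.symm.dvd
  · have hm' : (2 : ℝ) ^ d = 1 + s * m := by exact_mod_cast eq_add_of_sub_eq' hm
    refine ⟨2 ^ j * t * m, Or.inl ?_⟩
    push_cast
    rw [pow_add, hm']
    field_simp
    ring
  · have hm' : (2 : ℝ) ^ d = -1 + s * m := by exact_mod_cast eq_add_of_sub_eq' hm
    refine ⟨2 ^ j * t * m, Or.inr ?_⟩
    push_cast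
    rw [pow_add, hm']
    field_simp
    ring

theorem two_pow_modEq_of_cos_eq {s : ℕ} (hs : s ≠ 0) {t : ℤ} (hco : Int.gcd t s = 1) {p : ℕ}
    (h : cos (2 * t * π / s) = cos (2 ^ (p + 1) * t * π / s)) :
    Int.ModEq (s : ℤ) (2 ^ p) 1 ∨ Int.ModEq (s : ℤ) (2 ^ p) (-1) := by
  have hs' : (s : ℝ) ≠ 0 := Nat.cast_ne_zero.2 hs
  have hcop : IsCoprime (s : ℤ) t := (Int.isCoprime_iff_gcd_eq_one.2 hco).symm
  obtain ⟨k, hk⟩ := cos_eq_cos_iff.1 h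
  refine hk.imp (fun hk => ?_) fun hk => ?_ <;>
    refine (Int.modEq_iff_dvd.2 (hcop.dvd_of_dvd_mul_right ⟨k, ?_⟩)).symm <;>
    field_simp at hk <;> rw [pow_succ] at hk
  · have : ((2 ^ p - 1) * t : ℝ) = s * k := by linarith
    exact_mod_cast this
  · have : ((2 ^ p - -1) * t : ℝ) = s * k := by linarith
    exact_mod_cast this

/-- Theorem 4 (minimal period): for odd `s ≥ 3` and `t` coprime to `s` with
`0 < t/s < 1/2`, the minimal period of the totally periodic sign sequence
`ε_i = cos(2^i tπ/s)/|cos(2^i tπ/s)|` equals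
`min {d ≥ 1 | 2^d ≡ ±1 (mod s)}`: that minimum is a period of `ε` and is
least among all periods. -/
theorem minimal_period_eq (s : ℕ) (hs : 3 ≤ s) (hodd : Odd s)
    (t : ℤ) (hco : Int.gcd t s = 1)
    (ht0 : 0 < (t : ℝ) / s) (ht1 : (t : ℝ) / s < 1 / 2)
    (ε : ℕ → ℝ)
    (hε : ∀ i, 1 ≤ i →
      ε i = Real.cos (2 ^ i * t * π / s) / |Real.cos (2 ^ i * t * π / s)|) :
    IsLeast {p : ℕ | 1 ≤ p ∧ ∀ i, 1 ≤ i → ε (i + p) = ε i}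
      (sInf {d : ℕ | 1 ≤ d ∧
        (Int.ModEq (s : ℤ) (2 ^ d) 1 ∨ Int.ModEq (s : ℤ) (2 ^ d) (-1))}) := by
  have hs0 : s ≠ 0 := by omega
  have hne : {d : ℕ | 1 ≤ d ∧
      (Int.ModEq (s : ℤ) (2 ^ d) 1 ∨ Int.ModEq (s : ℤ) (2 ^ d) (-1))}.Nonempty :=
    ⟨s.totient, Nat.totient_pos.2 (by omega), Or.inl <| by
      exact_mod_cast Int.natCast_modEq_iff.2 (Nat.ModEq.pow_totient hodd.coprime_two_left)⟩
  obtain ⟨hd1, hd⟩ := Nat.sInf_mem hne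
  refine ⟨⟨hd1, fun i hi => ?_⟩, fun p hp => Nat.sInf_le ⟨hp.1, ?_⟩⟩
  · rw [hε _ (by omega), hε i hi, cos_two_pow_add_eq hs0 t hd hi]
  · refine two_pow_modEq_of_cos_eq hs0 hco (cos_eq_of_signs_eq fun k => ?_)
    have h := hp.2 (k + 1) (by omega)
    rw [hε _ (by omega), hε _ (by omega)] at h
    convert h.symm using 4 <;> ring_nf
end

section
/- Let ε : ℕ → ℝ with ε i ∈ {-1, 1} for all i ≥ 1 be totally periodic with period p ≥ 1, and suppose δ_p = ε₁ε₂⋯ε_p = −1. Then for all m ≥ 0 and 0 ≤ j ≤ p−1, r_{mp+j} = 2·cos((1 − 2^p σ_p/(2^p + 1) + ((−1)^m/2^{mp})·2^p σ_p/(2^p + 1) − (−1)^m σ_j/2^{mp})·π/4), where σ_j = Σ_{i=1}^j δ_i/2^i (with σ_0 = 0) and δ_i = ε₁ε₂⋯ε_i. -/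
open Filter Real

/-- `δ_i = ε₁ε₂⋯ε_i`, with `δ_0 = 1` (empty product). -/
noncomputable def del (ε : ℕ → ℝ) (i : ℕ) : ℝ := ∏ j ∈ Finset.Icc 1 i, ε j

/-- `σ_j = Σ_{i=1}^j δ_i / 2^i`, with `σ_0 = 0`. -/
noncomputable def sig (ε : ℕ → ℝ) (j : ℕ) : ℝ :=
  ∑ i ∈ Finset.Icc 1 j, del ε i / 2 ^ i

theorem sqrt_two_add_two_mul_sin_s13 {x : ℝ} (hx₁ : -(π / 2) ≤ x) (hx₂ : x ≤ π / 2) :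
    Real.sqrt (2 + 2 * Real.sin x) = 2 * Real.sin (π / 4 + x / 2) := by
  have h : 2 + 2 * Real.sin x = (2 * Real.sin (π / 4 + x / 2)) ^ 2 := by
    have hc : Real.cos (2 * (π / 4 + x / 2)) = -Real.sin x := by
      rw [← Real.cos_add_pi_div_two]
      ring_nf
    have hs := Real.sin_sq_eq_half_sub (π / 4 + x / 2)
    rw [hc] at hs
    rw [mul_pow, hs]
    ring
  rw [h, Real.sqrt_sq]
  have := Real.sin_nonneg_of_nonneg_of_le_pi (x := π / 4 + x / 2) (by linarith) (by linarith)
  positivity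

theorem del_succ (ε : ℕ → ℝ) (n : ℕ) : del ε (n + 1) = del ε n * ε (n + 1) :=
  Finset.prod_Icc_succ_top (by lia) _

theorem sig_succ (ε : ℕ → ℝ) (n : ℕ) :
    sig ε (n + 1) = sig ε n + del ε (n + 1) / 2 ^ (n + 1) :=
  Finset.sum_Icc_succ_top (by lia) _

theorem nest_two_mul_sin_s13 (ε : ℕ → ℝ) (hε : ∀ i, 1 ≤ i → ε i = 1 ∨ ε i = -1) (n : ℕ) :
    ∀ x : ℝ, -(π / 2) ≤ x → x ≤ π / 2 → nest ε n (2 * Real.sin x) =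
      2 * Real.cos ((1 - sig ε n) * (π / 4) - del ε n * x / 2 ^ (n + 1)) := by
  induction n with
  | zero =>
    intro x hx₁ hx₂
    rw [nest, sqrt_two_add_two_mul_sin_s13 hx₁ hx₂, ← Real.cos_pi_div_two_sub]
    simp only [sig, del, Finset.Icc_eq_empty_of_lt zero_lt_one, Finset.sum_empty,
      Finset.prod_empty]
    ring_nf
  | succ n ih =>
    intro x hx₁ hx₂
    have hsin : ε (n + 1) * (2 * Real.sin (π / 4 + x / 2)) =
        2 * Real.sin (ε (n + 1) * (π / 4 + x / 2)) := by
      rcases hε (n + 1) (by lia) with h | h <;> simp only [h, neg_mul, one_mul, Real.sin_neg, mul_neg]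
    rw [nest, sqrt_two_add_two_mul_sin_s13 hx₁ hx₂, hsin, ih, sig_succ, del_succ]
    · congr 2
      field_simp
      ring
    all_goals rcases hε (n + 1) (by lia) with h | h <;> rw [h] <;> linarith [Real.pi_pos]

theorem nest_zero_eq_cos (ε : ℕ → ℝ) (hε : ∀ i, 1 ≤ i → ε i = 1 ∨ ε i = -1) (n : ℕ) :
    nest ε n 0 = 2 * Real.cos ((1 - sig ε n) * (π / 4)) := by
  simpa using nest_two_mul_sin_s13 ε hε n 0 (by linarith [Real.pi_pos]) (by linarith [Real.pi_pos])

theorem del_add_period {ε : ℕ → ℝ} {p : ℕ} (hper : ∀ i, 1 ≤ i → ε (i + p) = ε i) (n : ℕ) :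
    del ε (n + p) = del ε p * del ε n := by
  induction n with
  | zero => simp [del]
  | succ n ih =>
    rw [Nat.add_right_comm, del_succ, ih, del_succ, Nat.add_right_comm, hper _ (by lia), mul_assoc]

theorem sig_add_period {ε : ℕ → ℝ} {p : ℕ} (hper : ∀ i, 1 ≤ i → ε (i + p) = ε i) (n : ℕ) :
    sig ε (n + p) = sig ε p + del ε p * sig ε n / 2 ^ p := by
  induction n with
  | zero => simp [sig]
  | succ n ih =>
    rw [Nat.add_right_comm, sig_succ, ih, sig_succ, Nat.add_right_comm, del_add_period hper]
    field_simp
    ring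

theorem sig_mul_period_add {ε : ℕ → ℝ} {p : ℕ} (hper : ∀ i, 1 ≤ i → ε (i + p) = ε i)
    (hδ : del ε p = -1) (m j : ℕ) :
    sig ε (m * p + j) = 2 ^ p * sig ε p / (2 ^ p + 1)
      - ((-1 : ℝ) ^ m / 2 ^ (m * p)) * (2 ^ p * sig ε p / (2 ^ p + 1))
      + (-1 : ℝ) ^ m * sig ε j / 2 ^ (m * p) := by
  induction m with
  | zero => simp
  | succ m ih =>
    rw [show (m + 1) * p + j = m * p + j + p by ring, sig_add_period hper, ih, hδ,
      Nat.succ_mul, pow_add, pow_succ (-1 : ℝ)]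
    field_simp
    ring

/-- Theorem 5, case `δ_p = -1`: closed form of `r_{mp+j}` for a totally
periodic sign sequence of period `p`. -/
theorem nest_periodic_closed_form_neg (ε : ℕ → ℝ)
    (hε : ∀ i, 1 ≤ i → ε i = 1 ∨ ε i = -1)
    (p : ℕ) (hp : 1 ≤ p) (hper : ∀ i, 1 ≤ i → ε (i + p) = ε i)
    (hδ : del ε p = -1) (m j : ℕ) (hj : j ≤ p - 1) :
    nest ε (m * p + j) 0 = 2 * Real.cos
      ((1 - 2 ^ p * sig ε p / (2 ^ p + 1)
        + ((-1 : ℝ) ^ m / 2 ^ (m * p)) * (2 ^ p * sig ε p / (2 ^ p + 1))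
        - (-1 : ℝ) ^ m * sig ε j / 2 ^ (m * p)) * (π / 4)) := by
  rw [nest_zero_eq_cos ε hε, sig_mul_period_add hper hδ]
  congr 2
  ring
end

section
/- Let ε : ℕ → ℝ with ε i ∈ {-1, 1} for all i ≥ 1 be totally periodic (ε_{i+p} = ε_i for all i ≥ 1, for some p ≥ 1). Set r_∞ = lim_{n→∞} r_n and u_n = 2^n·(r_∞ − r_n). Then every limit point L of the sequence (u_n) has the form L = α·π for some real number α that is algebraic over ℚ. -/
open Filter Real

/-- The nested radical with angular argument: the partial products of the signs are
`σ`, and `S` is a solution of `2 S n = σ (n + 1) + S (n + 1)`. -/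
lemma nest_two_mul_cos {ε : ℕ → ℝ} {σ S : ℕ → ℝ}
    (hε : ∀ i, 1 ≤ i → ε i = 1 ∨ ε i = -1) (hσ0 : σ 0 = 1)
    (hσ : ∀ n, σ (n + 1) = σ n * ε (n + 1)) (hS : ∀ n, 2 * S n = σ (n + 1) + S (n + 1))
    (n : ℕ) {θ : ℝ} (h0 : 0 ≤ θ) (hπ : θ ≤ π) :
    nest ε n (2 * cos θ) =
      2 * cos (π * (1 - S 0) / 4 + π * S n / 2 ^ (n + 2) + σ n * (θ - π / 2) / 2 ^ (n + 1)) := by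
  have hsqrt {θ : ℝ} (h0 : 0 ≤ θ) (hπ : θ ≤ π) : √(2 + 2 * cos θ) = 2 * cos (θ / 2) := by
    have hc : 0 ≤ cos (θ / 2) := cos_nonneg_of_mem_Icc ⟨by linarith, by linarith⟩
    rw [show θ = 2 * (θ / 2) by ring, cos_two_mul, show 2 * (θ / 2) / 2 = θ / 2 by ring,
      show 2 + 2 * (2 * cos (θ / 2) ^ 2 - 1) = (2 * cos (θ / 2)) ^ 2 by ring,
      sqrt_sq (by positivity)]
  induction n generalizing θ with
  | zero =>
    rw [nest, hsqrt h0 hπ, hσ0]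
    ring_nf
  | succ n ih =>
    have hstep : ε (n + 1) * √(2 + 2 * cos θ) = 2 * cos (π / 2 + ε (n + 1) * (θ - π) / 2) := by
      rw [hsqrt h0 hπ]
      rcases hε (n + 1) (by omega) with h | h
      · rw [h]
        ring_nf
      · rw [h, show π / 2 + -1 * (θ - π) / 2 = π - θ / 2 by ring, cos_pi_sub]
        ring
    have hSn : S n = (σ n * ε (n + 1) + S (n + 1)) / 2 := by
      rw [← hσ]
      linarith [hS n]
    rw [nest, hstep, ih, hSn, hσ]
    · congr 2
      field_simp
      ring
    all_goals rcases hε (n + 1) (by omega) with h | h <;> rw [h] <;> linarith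

lemma exists_periodic_two_mul_eq {σ : ℕ → ℚ} {q : ℕ} (hq : 0 < q) (hσ : Function.Periodic σ q) :
    ∃ S : ℕ → ℚ, Function.Periodic S q ∧ ∀ n, 2 * S n = σ (n + 1) + S (n + 1) := by
  refine ⟨fun n => (∑ j ∈ Finset.range q, σ (n + 1 + j) * (1 / 2) ^ (j + 1)) / (1 - (1 / 2) ^ q),
    fun n => ?_, fun n => ?_⟩
  · have h (j : ℕ) : σ (n + q + 1 + j) = σ (n + 1 + j) := by
      rw [← hσ (n + 1 + j)]
      congr 1
      ring
    simp only [h]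
  · have hne : (1 - (1 / 2) ^ q : ℚ) ≠ 0 := by
      have : (1 / 2 : ℚ) ^ q < 1 := pow_lt_one₀ (by norm_num) (by norm_num) hq.ne'
      linarith
    have h := (Finset.sum_range_succ (fun j => σ (n + 1 + j) * (1 / 2 : ℚ) ^ j) q).symm.trans
      (Finset.sum_range_succ' _ q)
    have h1 : ∑ j ∈ Finset.range q, σ (n + 1 + j) * (1 / 2 : ℚ) ^ j =
        2 * ∑ j ∈ Finset.range q, σ (n + 1 + j) * (1 / 2 : ℚ) ^ (j + 1) := by
      rw [Finset.mul_sum]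
      refine Finset.sum_congr rfl fun j _ => ?_
      ring
    have h2 (j : ℕ) : σ (n + 1 + (j + 1)) = σ (n + 1 + 1 + j) := by
      congr 1
      ring
    simp only [h1, h2, pow_zero, mul_one, add_zero, hσ (n + 1)] at h
    have h3 : ∑ j ∈ Finset.range q, σ (n + 1 + 1 + j) * (1 / 2 : ℚ) ^ (j + 1) =
        2 * (∑ j ∈ Finset.range q, σ (n + 1 + j) * (1 / 2 : ℚ) ^ (j + 1)) -
          σ (n + 1) * (1 - (1 / 2) ^ q) := by
      linarith
    beta_reduce
    rw [h3, sub_div, mul_div_cancel_right₀ _ hne]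
    ring

lemma periodic_prod_range {M : Type*} [CommMonoid M] {e : ℕ → M} {p : ℕ}
    (he : Function.Periodic e p) (hsq : ∀ i, e i ^ 2 = 1) :
    Function.Periodic (fun n => ∏ i ∈ Finset.range n, e i) (2 * p) := fun n => by
  have h (m : ℕ) : ∏ i ∈ Finset.range (p + m), e i =
      (∏ i ∈ Finset.range p, e i) * ∏ i ∈ Finset.range m, e i := by
    simp only [Finset.prod_range_add, fun i => (add_comm p i ▸ he i : e (p + i) = e i)]
  change ∏ i ∈ Finset.range (n + 2 * p), e i = _
  rw [show n + 2 * p = p + (p + n) by ring, h, h, ← mul_assoc, ← pow_two, ← Finset.prod_pow]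
  simp [hsq]

lemma Function.Periodic.finite_range_nat {α : Type*} {f : ℕ → α} {q : ℕ} (hq : 0 < q)
    (hf : Function.Periodic f q) : (Set.range f).Finite := by
  refine ((Set.finite_lt_nat q).image f).subset ?_
  rintro _ ⟨n, rfl⟩
  exact ⟨n % q, Nat.mod_lt _ hq, hf.map_mod_nat n⟩

/-- First-order expansion of the cosine along a sequence approaching its base point at
geometric speed. -/
lemma tendsto_two_pow_mul_cos_sub {b : ℕ → ℝ} (hb : (Set.range b).Finite) (Φ : ℝ) :
    Tendsto (fun n => 2 ^ n * (cos (Φ + b n / 2 ^ n) - cos Φ) + sin Φ * b n) atTop (nhds 0) ∧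
      Tendsto (fun n => cos (Φ + b n / 2 ^ n)) atTop (nhds (cos Φ)) := by
  have hpow : Tendsto (fun n : ℕ => ((2 : ℝ) ^ n)⁻¹) atTop (nhds 0) :=
    tendsto_inv_atTop_zero.comp (tendsto_pow_atTop_atTop_of_one_lt one_lt_two)
  obtain ⟨C, hC⟩ := hb.isBounded.exists_norm_le
  have hbig : (fun n => b n / 2 ^ n) =O[atTop] fun n : ℕ => ((2 : ℝ) ^ n)⁻¹ := by
    refine Asymptotics.IsBigO.of_bound C (Eventually.of_forall fun n => ?_)
    rw [div_eq_mul_inv, norm_mul]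
    exact mul_le_mul_of_nonneg_right (hC _ ⟨n, rfl⟩) (norm_nonneg _)
  have hb0 : Tendsto (fun n => b n / 2 ^ n) atTop (nhds 0) := hbig.trans_tendsto hpow
  constructor
  · have h := ((hasDerivAt_iff_isLittleO_nhds_zero.1 (hasDerivAt_cos Φ)).comp_tendsto
      hb0).trans_isBigO hbig
    refine h.tendsto_div_nhds_zero.congr fun n => ?_
    simp only [Function.comp, smul_eq_mul]
    field_simp
    ring
  · have h := (continuous_cos.tendsto (Φ + 0)).comp (hb0.const_add Φ)
    rwa [add_zero] at h

/-- Corollary 6.1: for a totally periodic sign sequence, every limit point of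
`u_n = 2^n (r_∞ - r_n)` has the form `α π` with `α` algebraic over `ℚ`. -/
theorem limit_points_algebraic (ε : ℕ → ℝ)
    (hε : ∀ i, 1 ≤ i → ε i = 1 ∨ ε i = -1)
    (p : ℕ) (hp : 1 ≤ p) (hper : ∀ i, 1 ≤ i → ε (i + p) = ε i)
    (rinf : ℝ)
    (hlim : Filter.Tendsto (fun n => nest ε n 0) Filter.atTop (nhds rinf))
    (u : ℕ → ℝ) (hu : ∀ n, u n = 2 ^ n * (rinf - nest ε n 0)) :
    ∀ L : ℝ, MapClusterPt L Filter.atTop u →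
      ∃ α : ℝ, IsAlgebraic ℚ α ∧ L = α * π := by
  intro L hL
  set e : ℕ → ℚ := fun i => if ε (i + 1) = 1 then 1 else -1 with he
  have he_eq (i : ℕ) : ε (i + 1) = e i := by
    rcases hε (i + 1) (by omega) with h | h <;> simp only [he, h] <;> norm_num
  have he_sq (i : ℕ) : e i ^ 2 = 1 := by
    simp only [he]
    split_ifs <;> norm_num
  have he_per : Function.Periodic e p := fun i => by
    simp only [he, add_right_comm i p 1, hper (i + 1) (by omega)]
  set σ : ℕ → ℚ := fun n => ∏ i ∈ Finset.range n, e i with hσ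
  have hq : 0 < 2 * p := by omega
  obtain ⟨S, hS_per, hS⟩ := exists_periodic_two_mul_eq hq (periodic_prod_range he_per he_sq)
  set Φ : ℝ := π * (1 - S 0) / 4 with hΦ
  set b : ℕ → ℝ := fun n => π * S n / 4 with hb
  have hb_fin : (Set.range b).Finite := by
    refine Function.Periodic.finite_range_nat hq fun n => ?_
    simp only [hb, hS_per n]
  have hnest (n : ℕ) : nest ε n 0 = 2 * cos (Φ + b n / 2 ^ n) := by
    have h := nest_two_mul_cos (σ := fun n => σ n) (S := fun n => S n) hε (by simp [hσ])
      (fun n => by simp [hσ, Finset.prod_range_succ, he_eq]) (fun n => by exact_mod_cast hS n) n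
      (θ := π / 2) (by positivity) (by linarith [pi_pos])
    rw [cos_pi_div_two, mul_zero] at h
    rw [h]
    congr 2
    simp only [hΦ, hb]
    field_simp
    ring
  obtain ⟨hdiff, hcos⟩ := tendsto_two_pow_mul_cos_sub hb_fin Φ
  have hrinf : rinf = 2 * cos Φ :=
    tendsto_nhds_unique hlim ((hcos.const_mul 2).congr fun n => (hnest n).symm)
  obtain ⟨φ, hφ, hφL⟩ := hL.tendsto_subseq
  have hmem : L ∈ (fun x => 2 * sin Φ * x) '' Set.range b := by
    refine (hb_fin.image _).isClosed.mem_of_tendsto (f := fun n => 2 * sin Φ * b (φ n)) (b := atTop)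
      ?_ (Eventually.of_forall fun n => ⟨_, ⟨φ n, rfl⟩, rfl⟩)
    have h := hφL.add ((hdiff.comp hφ.tendsto_atTop).const_mul 2)
    rw [mul_zero, add_zero] at h
    refine h.congr fun n => ?_
    simp only [Function.comp, hu, hrinf, hnest]
    ring
  obtain ⟨_, ⟨n, rfl⟩, rfl⟩ := hmem
  refine ⟨2 * sin Φ * ((S n / 4 : ℚ) : ℝ), ?_, ?_⟩
  · have hsin : IsAlgebraic ℚ (sin Φ) := by
      have h := isAlgebraic_sin_rat_mul_pi ((1 - S 0) / 4)
      rw [show (((1 - S 0) / 4 : ℚ) : ℝ) * π = Φ by simp only [hΦ]; push_cast; ring] at h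
      exact h.extendScalars Int.cast_injective
    exact ((isAlgebraic_algebraMap (2 : ℚ)).mul hsin).mul (isAlgebraic_algebraMap (S n / 4))
  · simp only [hb]
    push_cast
    ring
end

section
/- Let k ≥ 1 and t ∈ {1, …, k} with gcd(t, 2k+1) = 1, and set q = t/(2k+1). Let p = min{d ≥ 1 : 2^d ≡ 1 or −1 (mod 2k+1)}, and define ε_i = cos(2^i qπ)/|cos(2^i qπ)| for i = 1, …, p. Define the sequence (s_n) by s_0 = √2 and s_{pn+i} = √(2 + ε_{p+1−i}·s_{pn+i−1}) for all n ≥ 0 and i ∈ {1, …, p}. Then (1/π)·(2 cos 2qπ)/((1 − 4q) sin qπ) = ((2 cos qπ + √2)/2) · Π_{i=0}^∞ Π_{j=1}^p ((|2 cos(2^{p−j} qπ)| + s_{pi+j})/2), where the infinite product converges. -/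
open Filter Real

/-- The half-angle formula `√(2 + e · 2 cos x) = 2 cos y`, with `y = x / 2` if `e = 1` and
`y = π / 2 - x / 2` if `e = -1`. -/
lemma sqrt_two_add_sign_mul_cos {e x : ℝ} (he : e = 1 ∨ e = -1)
    (hx : x ∈ Set.Icc 0 (π / 2)) :
    (1 - e) * (π / 4) + e * x / 2 ∈ Set.Icc 0 (π / 2) ∧
      √(2 + e * (2 * cos x)) = 2 * cos ((1 - e) * (π / 4) + e * x / 2) := by
  obtain ⟨h0, h1⟩ := hx
  have hmem : (1 - e) * (π / 4) + e * x / 2 ∈ Set.Icc 0 (π / 2) := by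
    rcases he with rfl | rfl <;> constructor <;> linarith
  refine ⟨hmem, ?_⟩
  have hcos : 0 ≤ cos ((1 - e) * (π / 4) + e * x / 2) :=
    cos_nonneg_of_mem_Icc ⟨by linarith [hmem.1, pi_pos], hmem.2⟩
  rw [← sqrt_sq (mul_nonneg zero_le_two hcos)]
  congr 1
  have hsq := cos_sq ((1 - e) * (π / 4) + e * x / 2)
  have hdouble : cos (2 * ((1 - e) * (π / 4) + e * x / 2)) = e * cos x := by
    rcases he with rfl | rfl
    · ring_nf
    · rw [show 2 * ((1 - -1) * (π / 4) + -1 * x / 2) = π - x by ring, cos_pi_sub]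
      ring
  rw [hdouble] at hsq
  linear_combination -4 * hsq

/-- Two orbits `s`, `c` of the same sequence of maps `x ↦ √(2 + e x)` have angles whose difference
is multiplied by `e / 2` at each step, and the products of `(c + s) / 2` telescope. -/
lemma exists_angles_of_sqrt_recursion {e c s : ℕ → ℝ} {a x : ℝ}
    (he : ∀ m, e m = 1 ∨ e m = -1)
    (hs : ∀ m, s (m + 1) = √(2 + e m * s m)) (hc : ∀ m, c (m + 1) = √(2 + e m * c m))
    (ha : a ∈ Set.Icc 0 (π / 2)) (hx : x ∈ Set.Icc 0 (π / 2))
    (hca : c 0 = 2 * cos a) (hsx : s 0 = 2 * cos x) (m : ℕ) :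
    ∃ b y d : ℝ, b ∈ Set.Icc 0 (π / 2) ∧ y ∈ Set.Icc 0 (π / 2) ∧
      c m = 2 * cos b ∧ s m = 2 * cos y ∧ y = b + d * (x - a) ∧ |d| = (1 / 2) ^ m ∧
      (∏ j ∈ Finset.range m, (c (j + 1) + s (j + 1)) / 2) * (s m - c m) = d * (s 0 - c 0) := by
  induction m with
  | zero => exact ⟨a, x, 1, ha, hx, hca, hsx, by ring, by simp, by simp⟩
  | succ m ih =>
    obtain ⟨b, y, d, hb, hy, hcb, hsy, hyb, hd, hprod⟩ := ih
    obtain ⟨hb', hcb'⟩ := sqrt_two_add_sign_mul_cos (he m) hb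
    obtain ⟨hy', hsy'⟩ := sqrt_two_add_sign_mul_cos (he m) hy
    refine ⟨_, _, e m * d / 2, hb', hy', by rw [hc, hcb, hcb'], by rw [hs, hsy, hsy'], ?_, ?_, ?_⟩
    · rw [hyb]
      ring
    · have habs : |e m| = 1 := by rcases he m with h | h <;> simp [h]
      rw [abs_div, abs_mul, habs, hd, abs_two, pow_succ]
      ring
    · have hs2 : s (m + 1) ^ 2 = 2 + e m * s m := by
        rw [hs, sq_sqrt]
        rw [hsy]
        rcases he m with h | h <;> rw [h] <;> linarith [cos_le_one y, neg_one_le_cos y]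
      have hc2 : c (m + 1) ^ 2 = 2 + e m * c m := by
        rw [hc, sq_sqrt]
        rw [hcb]
        rcases he m with h | h <;> rw [h] <;> linarith [cos_le_one b, neg_one_le_cos b]
      rw [Finset.prod_range_succ]
      linear_combination (∏ j ∈ Finset.range m, (c (j + 1) + s (j + 1)) / 2) / 2 * (hs2 - hc2)
        + e m / 2 * hprod

lemma tendsto_of_mul_cos_sub_cos {P d : ℕ → ℝ} {a w K : ℝ} (hw : w ≠ 0) (ha : sin a ≠ 0)
    (hd : Tendsto d atTop (nhds 0)) (hd0 : ∀ n, d n ≠ 0)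
    (hP : ∀ n, P n * (2 * cos (a + d n * w) - 2 * cos a) = d n * K) (hK : K ≠ 0) :
    Tendsto P atTop (nhds (K / (-2 * w * sin a))) := by
  have hder : HasDerivAt (fun u : ℝ => 2 * cos (a + u * w)) (-2 * w * sin a) 0 := by
    have h := (((hasDerivAt_id (0 : ℝ)).mul_const w).const_add a).cos.const_mul 2
    simp only [id, zero_mul, add_zero, one_mul] at h
    exact h.congr_deriv (by ring)
  have hslope := hder.tendsto_slope_zero.comp
    (tendsto_nhdsWithin_iff.2 ⟨hd, Eventually.of_forall hd0⟩)
  have hlim := (tendsto_const_nhds (x := K)).div hslope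
    (mul_ne_zero (mul_ne_zero (by norm_num) hw) ha)
  refine hlim.congr fun n => ?_
  simp only [Function.comp_apply, Pi.div_apply, zero_add, zero_mul, add_zero, smul_eq_mul]
  have hne : 2 * cos (a + d n * w) - 2 * cos a ≠ 0 := fun h => by
    have := hP n
    rw [h, mul_zero] at this
    exact mul_ne_zero (hd0 n) hK this.symm
  have := hd0 n
  rw [div_eq_iff (by positivity)]
  field_simp
  linear_combination -hP n

lemma cos_two_pow_mul_pi_ne_zero (k t i : ℕ) :
    cos (2 ^ i * ((t : ℝ) / (2 * k + 1)) * π) ≠ 0 := by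
  rw [Ne, cos_eq_zero_iff]
  rintro ⟨n, hn⟩
  have hk : (2 * k + 1 : ℝ) ≠ 0 := by positivity
  have h : (2 : ℝ) * (2 ^ i * t) = (2 * n + 1) * (2 * k + 1) := by
    field_simp at hn
    linear_combination hn
  have h' : (2 : ℤ) * (2 ^ i * t) = (2 * n + 1) * (2 * k + 1) := by exact_mod_cast h
  have hodd : Odd ((2 * (n : ℤ) + 1) * (2 * k + 1)) :=
    Odd.mul ⟨n, rfl⟩ ⟨k, rfl⟩
  rw [← h'] at hodd
  exact (Int.not_odd_iff_even.2 (even_two_mul _)) hodd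

lemma abs_cos_two_pow_mul_pi_of_modEq {k t p : ℕ}
    (hp : Int.ModEq ((2 * k + 1 : ℕ) : ℤ) (2 ^ p) 1 ∨
      Int.ModEq ((2 * k + 1 : ℕ) : ℤ) (2 ^ p) (-1)) :
    |cos (2 ^ p * ((t : ℝ) / (2 * k + 1)) * π)| = |cos ((t : ℝ) / (2 * k + 1) * π)| := by
  have hk : (2 * k + 1 : ℝ) ≠ 0 := by positivity
  have habs (x : ℝ) (n : ℤ) : |cos (x + n * π)| = |cos x| := by
    rw [cos_add_int_mul_pi, abs_mul, abs_zpow, abs_neg, abs_one, one_zpow, one_mul]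
  rcases hp with h | h
  · obtain ⟨m, hm⟩ := h.symm.dvd
    have hm' : (2 : ℝ) ^ p - 1 = (2 * k + 1) * m := by exact_mod_cast hm
    rw [← habs ((t : ℝ) / (2 * k + 1) * π) (m * t)]
    congr 2
    push_cast
    field_simp
    linear_combination (t : ℝ) * hm'
  · obtain ⟨m, hm⟩ := h.symm.dvd
    have hm' : (2 : ℝ) ^ p + 1 = (2 * k + 1) * m := by
      have : (2 : ℤ) ^ p + 1 = (2 * k + 1) * m := by
        rw [← sub_neg_eq_add, hm]
        push_cast
        ring
      exact_mod_cast this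
    rw [← cos_neg ((t : ℝ) / (2 * k + 1) * π), ← habs (-((t : ℝ) / (2 * k + 1) * π)) (m * t)]
    congr 2
    push_cast
    field_simp
    linear_combination (t : ℝ) * hm'

lemma abs_two_mul_cos_eq_sqrt (x : ℝ) :
    |2 * cos x| = √(2 + cos (2 * x) / |cos (2 * x)| * |2 * cos (2 * x)|) := by
  have h : cos (2 * x) / |cos (2 * x)| * |2 * cos (2 * x)| = 2 * cos (2 * x) := by
    rw [abs_mul, abs_two]
    rcases eq_or_ne (cos (2 * x)) 0 with h0 | h0
    · simp [h0]
    · field_simp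
  rw [h, cos_two_mul, ← sqrt_sq_eq_abs]
  ring_nf

lemma prod_range_prod_Icc_eq_prod_range_mul (f : ℕ → ℝ) (p N : ℕ) :
    ∏ i ∈ Finset.range N, ∏ j ∈ Finset.Icc 1 p, f (p * i + j) =
      ∏ m ∈ Finset.range (p * N), f (m + 1) := by
  induction N with
  | zero => simp
  | succ N ih =>
    rw [Finset.prod_range_succ, ih, mul_add, mul_one, Finset.prod_range_add,
      ← Finset.Ico_add_one_right_eq_Icc, Finset.prod_Ico_eq_prod_range]
    refine congrArg _ (Finset.prod_congr rfl fun j _ => ?_)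
    congr 1
    ring

/-- Theorem 7 (generalized Vieta product): let `q = t/(2k+1) ∈ (0, 1/2)` be a
rational with odd denominator, `p = min {d ≥ 1 | 2^d ≡ ±1 (mod 2k+1)}`,
`ε_i = cos(2^i qπ)/|cos(2^i qπ)|` for `i = 1, …, p`, and let `(s_n)` be built by
`s₀ = √2`, `s_{pn+i} = √(2 + ε_{p+1-i} s_{pn+i-1})` for `n ≥ 0`, `1 ≤ i ≤ p`.
Then the infinite product `Π_{i=0}^∞ Π_{j=1}^p (|2 cos(2^{p-j} qπ)| + s_{pi+j})/2`
converges, and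
`(1/π)(2 cos 2qπ)/((1-4q) sin qπ) = ((2 cos qπ + √2)/2) · Π Π (⋯)`. -/
theorem generalized_vieta_product (k : ℕ) (hk : 1 ≤ k)
    (t : ℕ) (ht1 : 1 ≤ t) (htk : t ≤ k) (hco : Nat.Coprime t (2 * k + 1))
    (q : ℝ) (hq : q = (t : ℝ) / (2 * k + 1))
    (p : ℕ)
    (hp : IsLeast {d : ℕ | 1 ≤ d ∧
      (Int.ModEq ((2 * k + 1 : ℕ) : ℤ) (2 ^ d) 1 ∨
        Int.ModEq ((2 * k + 1 : ℕ) : ℤ) (2 ^ d) (-1))} p)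
    (ε : ℕ → ℝ)
    (hε : ∀ i, 1 ≤ i → i ≤ p →
      ε i = Real.cos (2 ^ i * q * π) / |Real.cos (2 ^ i * q * π)|)
    (s : ℕ → ℝ) (hs0 : s 0 = Real.sqrt 2)
    (hs : ∀ n : ℕ, ∀ i, 1 ≤ i → i ≤ p →
      s (p * n + i) = Real.sqrt (2 + ε (p + 1 - i) * s (p * n + i - 1))) :
    ∃ P : ℝ,
      Filter.Tendsto
        (fun N => ∏ i ∈ Finset.range N, ∏ j ∈ Finset.Icc 1 p,
          ((|2 * Real.cos (2 ^ (p - j) * q * π)| + s (p * i + j)) / 2))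
        Filter.atTop (nhds P) ∧
      (1 / π) * (2 * Real.cos (2 * q * π)) / ((1 - 4 * q) * Real.sin (q * π))
        = ((2 * Real.cos (q * π) + Real.sqrt 2) / 2) * P := by
  obtain ⟨⟨hp1, hpmod⟩, -⟩ := hp
  have hkpos : (0 : ℝ) < 2 * k + 1 := by positivity
  have hqpos : 0 < q := by
    rw [hq]
    have : (1 : ℝ) ≤ t := by exact_mod_cast ht1
    positivity
  have hqhalf : q < 1 / 2 := by
    rw [hq, div_lt_iff₀ hkpos]
    have : (t : ℝ) ≤ k := by exact_mod_cast htk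
    linarith
  have hcos_ne (i : ℕ) : cos (2 ^ i * q * π) ≠ 0 := hq ▸ cos_two_pow_mul_pi_ne_zero k t i
  have hcos_period : |cos (2 ^ p * q * π)| = |cos (q * π)| :=
    hq ▸ abs_cos_two_pow_mul_pi_of_modEq hpmod
  have hqπ : q * π ∈ Set.Icc 0 (π / 2) := by constructor <;> nlinarith [pi_pos]
  have hcosq : 0 ≤ cos (q * π) :=
    cos_nonneg_of_mem_Icc ⟨by linarith [hqπ.1, pi_pos], hqπ.2⟩
  have hsin : sin (q * π) ≠ 0 :=
    (sin_pos_of_pos_of_lt_pi (by positivity) (by nlinarith [pi_pos])).ne'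
  set c : ℕ → ℝ := fun m => |2 * cos (2 ^ (p - m % p) * q * π)| with hc_def
  set e : ℕ → ℝ := fun m => ε (p - m % p)
  have hc_block (n j : ℕ) (hj : j ≤ p) : c (p * n + j) = |2 * cos (2 ^ (p - j) * q * π)| := by
    rcases hj.lt_or_eq with hj | rfl
    · simp only [hc_def, Nat.mul_add_mod, Nat.mod_eq_of_lt hj]
    · simp [hc_def, abs_mul, hcos_period]
  have hc_mul (n : ℕ) : c (p * n) = 2 * cos (q * π) := by
    have h := hc_block n 0 p.zero_le
    rw [add_zero, Nat.sub_zero, abs_mul, hcos_period, abs_two, abs_of_nonneg hcosq] at h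
    exact h
  have hmod (m : ℕ) : m % p < p := Nat.mod_lt _ hp1
  have heq (m : ℕ) :
      e m = cos (2 ^ (p - m % p) * q * π) / |cos (2 ^ (p - m % p) * q * π)| :=
    hε _ (by have := hmod m; omega) (by omega)
  have he (m : ℕ) : e m = 1 ∨ e m = -1 := by
    rw [heq]
    rcases lt_or_gt_of_ne (hcos_ne (p - m % p)) with h | h
    · right
      rw [abs_of_neg h, div_neg, div_self h.ne]
    · left
      rw [abs_of_pos h, div_self h.ne']
  have hs_rec (m : ℕ) : s (m + 1) = √(2 + e m * s m) := by
    have h := hs (m / p) (m % p + 1) (by omega) (hmod m)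
    rwa [← add_assoc, Nat.div_add_mod, Nat.add_sub_cancel, Nat.add_sub_add_right] at h
  have hc_rec (m : ℕ) : c (m + 1) = √(2 + e m * c m) := by
    have h := hc_block (m / p) (m % p + 1) (hmod m)
    rw [← add_assoc, Nat.div_add_mod, abs_two_mul_cos_eq_sqrt] at h
    have hpow : 2 * ((2 : ℝ) ^ (p - (m % p + 1)) * q * π) = 2 ^ (p - m % p) * q * π := by
      rw [show p - m % p = p - (m % p + 1) + 1 by have := hmod m; omega, pow_succ]
      ring
    rw [hpow] at h
    rw [h, heq]
  have hc0 : c 0 = 2 * cos (q * π) := hc_mul 0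
  have hs0' : s 0 = 2 * cos (π / 4) := by
    rw [hs0, cos_pi_div_four]
    ring
  have hangles (N : ℕ) : ∃ d : ℝ, |d| = (1 / 2) ^ (p * N) ∧
      (∏ m ∈ Finset.range (p * N), (c (m + 1) + s (m + 1)) / 2) *
        (2 * cos (q * π + d * (π / 4 - q * π)) - 2 * cos (q * π)) = d * (s 0 - c 0) := by
    obtain ⟨b, y, d, hb, -, hcb, hsy, rfl, hd, hprod⟩ := exists_angles_of_sqrt_recursion he hs_rec
      hc_rec hqπ ⟨by positivity, by linarith [pi_pos]⟩ hc0 hs0' (p * N)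
    have hbq : b = q * π :=
      injOn_cos ⟨hb.1, by linarith [hb.2, pi_pos]⟩ ⟨hqπ.1, by linarith [hqπ.2, pi_pos]⟩
        (by linarith [hc_mul N])
    subst hbq
    exact ⟨d, hd, by rwa [hsy, hcb] at hprod⟩
  choose d hd hprod using hangles
  have hd0 (N : ℕ) : d N ≠ 0 := by
    rw [← abs_pos, hd]
    positivity
  have hd_lim : Tendsto d atTop (nhds 0) := by
    rw [tendsto_zero_iff_abs_tendsto_zero]
    have h := tendsto_pow_atTop_nhds_zero_of_lt_one (r := (1 / 2 : ℝ) ^ p) (by positivity)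
      (pow_lt_one₀ (by norm_num) (by norm_num) (by omega))
    exact h.congr fun N => by rw [Function.comp_apply, hd, pow_mul]
  have hfactor : (2 * cos (q * π) + √2) * (s 0 - c 0) = -2 * cos (2 * q * π) := by
    rw [hs0, hc0, mul_assoc, cos_two_mul]
    linear_combination sq_sqrt (zero_le_two (α := ℝ))
  have hcos2 : cos (2 * q * π) ≠ 0 := by simpa using hcos_ne 1
  have hK : s 0 - c 0 ≠ 0 := fun h => hcos2 (by rw [h] at hfactor; linarith)
  have hq4 : 1 - 4 * q ≠ 0 := fun h => hcos2 (by
    rw [show 2 * q * π = π / 2 by linear_combination -π / 2 * h, cos_pi_div_two])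
  have hw : π / 4 - q * π ≠ 0 := by
    rw [show π / 4 - q * π = π * (1 - 4 * q) / 4 by ring]
    exact div_ne_zero (mul_ne_zero pi_ne_zero hq4) four_ne_zero
  refine ⟨_, (tendsto_of_mul_cos_sub_cos hw hsin hd_lim hd0 hprod hK).congr fun N => ?_, ?_⟩
  · rw [← prod_range_prod_Icc_eq_prod_range_mul (fun m => (c m + s m) / 2)]
    refine Finset.prod_congr rfl fun i _ => Finset.prod_congr rfl fun j hj => ?_
    rw [hc_block i j (Finset.mem_Icc.1 hj).2]
  · rw [show -2 * (π / 4 - q * π) * sin (q * π) = -(π * (1 - 4 * q) * sin (q * π)) / 2 by ring]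
    have hπ := pi_ne_zero
    generalize s 0 - c 0 = K at hfactor
    generalize sin (q * π) = S at hsin
    generalize 1 - 4 * q = r at hq4
    generalize cos (2 * q * π) = C₂ at hfactor
    generalize cos (q * π) = C at hfactor
    field_simp
    linear_combination hfactor
end

section
/- Define the sequence (s_n) by s_0 = √2 and s_{n+1} = √(2 − s_n). Then the infinite product Π_{n=0}^∞ (1 + s_n)/2 converges and 2√3/π = Π_{n=0}^∞ (1 + s_n)/2, i.e. 2√3/π = ((1+√2)/2)·((1+√(2−√2))/2)·((1+√(2−√(2−√2)))/2)·⋯ (Vieta-like product of Aaron Levin). -/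
open Filter Real

theorem levin_seq_eq_two_mul_cos (s : ℕ → ℝ) (hs0 : s 0 = √2)
    (hrec : ∀ n, s (n + 1) = √(2 - s n)) (n : ℕ) :
    s n = 2 * cos (π / 3 + -(π / 12) * (-1 / 2) ^ n) := by
  induction n with
  | zero =>
    rw [hs0, show π / 3 + -(π / 12) * (-1 / 2) ^ 0 = π / 4 by ring, cos_pi_div_four]
    ring
  | succ n ih =>
    have hd : |(-1 / 2 : ℝ) ^ n| ≤ 1 := by
      rw [abs_pow]
      exact pow_le_one₀ (abs_nonneg _) (by norm_num [abs_le])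
    obtain ⟨h1, h2⟩ := abs_le.mp hd
    set x := π / 3 + -(π / 12) * (-1 / 2 : ℝ) ^ n with hx
    have hsin : 0 ≤ sin (x / 2) := by
      apply sin_nonneg_of_nonneg_of_le_pi <;> nlinarith [pi_pos]
    rw [hrec, ih, show π / 3 + -(π / 12) * (-1 / 2 : ℝ) ^ (n + 1) = π / 2 - x / 2 by
      rw [hx]; ring, cos_pi_div_two_sub, show 2 - 2 * cos x = (2 * sin (x / 2)) ^ 2 by
      have := cos_sq' (x / 2)
      have h := cos_two_mul (x / 2)
      rw [mul_div_cancel₀ x two_ne_zero] at h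
      linarith, sqrt_sq (by positivity)]

theorem levin_prod_mul (s : ℕ → ℝ) (hs0 : s 0 = √2)
    (hrec : ∀ n, s (n + 1) = √(2 - s n)) (n : ℕ) :
    (∏ k ∈ Finset.range (n + 1), (1 + s k) / 2) * ((s n - 1) * (-2) ^ (n + 1)) = -1 := by
  induction n with
  | zero =>
    have := sq_sqrt (zero_le_two (α := ℝ))
    simp only [zero_add, Finset.prod_range_one, hs0]
    linarith
  | succ n ih =>
    have hle : 0 ≤ 2 - s n := by
      rw [levin_seq_eq_two_mul_cos s hs0 hrec n]
      linarith [cos_le_one (π / 3 + -(π / 12) * (-1 / 2) ^ n)]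
    have hsq := sq_sqrt hle
    rw [← hrec] at hsq
    rw [Finset.prod_range_succ, pow_succ]
    linear_combination ih -
      (∏ k ∈ Finset.range (n + 1), (1 + s k) / 2) * (-2) ^ (n + 1) * hsq

/-- Aaron Levin's Vieta-like product: with `s₀ = √2`, `s_{n+1} = √(2 - s_n)`,
the infinite product `Π_{n=0}^∞ (1 + s_n)/2` converges and equals `2√3/π`. -/
theorem levin_vieta_product (s : ℕ → ℝ)
    (hs0 : s 0 = Real.sqrt 2)
    (hrec : ∀ n, s (n + 1) = Real.sqrt (2 - s n)) :
    Filter.Tendsto (fun N => ∏ n ∈ Finset.range N, (1 + s n) / 2)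
      Filter.atTop (nhds (2 * Real.sqrt 3 / π)) := by
  have hderiv : HasDerivAt (fun x => 2 * cos x) (-√3) (π / 3) := by
    have h := (hasDerivAt_cos (π / 3)).const_mul 2
    rwa [sin_pi_div_three, show 2 * -(√3 / 2) = -√3 by ring] at h
  set d : ℕ → ℝ := fun n => -(π / 12) * (-1 / 2) ^ n with hd
  have hd0 : Tendsto d atTop (nhds 0) := by
    simpa [hd] using (tendsto_pow_atTop_nhds_zero_of_abs_lt_one
      (by norm_num [abs_lt] : |(-1 / 2 : ℝ)| < 1)).const_mul (-(π / 12))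
  have hdne : ∀ n, d n ≠ 0 := fun n =>
    mul_ne_zero (by simp [pi_ne_zero]) (pow_ne_zero _ (by norm_num))
  have hslope := (hasDerivAt_iff_tendsto_slope_zero.mp hderiv).comp
    (tendsto_nhdsWithin_iff.mpr ⟨hd0, Eventually.of_forall hdne⟩)
  have hs3 : √3 ≠ 0 := by positivity
  have hlim := (hslope.mul_const (π / 6)).inv₀
    (mul_ne_zero (neg_ne_zero.mpr hs3) (by positivity)) |>.neg
  rw [← tendsto_add_atTop_iff_nat 1]
  convert hlim using 1
  · ext n
    have hp := levin_prod_mul s hs0 hrec n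
    have hmul : (s n - 1) * (-2) ^ (n + 1) = (d n)⁻¹ * (s n - 1) * (π / 6) := by
      have h : (-2 : ℝ) ^ (n + 1) * d n = π / 6 := by
        have : (-2 : ℝ) ^ n * (-1 / 2) ^ n = 1 := by rw [← mul_pow]; norm_num
        rw [hd, pow_succ]
        linear_combination π / 6 * this
      rw [← h]
      field_simp [hdne n]
    rw [hmul] at hp
    simp only [Function.comp_apply, smul_eq_mul, cos_pi_div_three]
    rw [← levin_seq_eq_two_mul_cos s hs0 hrec n, mul_one_div_cancel two_ne_zero]
    rw [← inv_neg]
    exact eq_inv_of_mul_eq_one_left (by linarith)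
  · congr 1
    have := sq_sqrt (zero_le_three (α := ℝ))
    field_simp
    linarith
end
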